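/- arXiv:2305.12465 — 2 statements merged into one kernel-verified Lean document; each statement's English description precedes it below -/
import Mathlib

section
/- Let H be a Hopf algebra with invertible antipode and B a braided-commutative right-right H-crossed module algebra. Then H²_◁(H,B) ≅ H²(B#H^op, B): the set of equivalence classes of Z²_◁(H,B) under the transformations γ ↦ γ^ϱ, γ^ϱ(h,g) := ϱ⁻¹(h₍₁₎) (ϱ⁻¹(g₍₁₎) ◁ h₍₂₎) γ(h₍₃₎, g₍₂₎) ϱ(g₍₃₎ h₍₄₎) for ϱ ∈ C¹_{◁,ver}(H,B), is in bijection with the set of equivalence classes of Z²(B#H^op,B) under the transformations Γ ↦ Γ^U for U ∈ C¹(B#H^op,B). -/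
open scoped TensorProduct
open TensorProduct

noncomputable section
attribute [local instance] Classical.propDecidable

/-- Choice-based lift of a (bilinear) function to the tensor product: if a linear map agreeing
with `f` on pure tensors exists, this is it (it is then unique); otherwise `0`. -/
def tlift (R : Type*) [CommRing R] {M N Q : Type*} [AddCommGroup M] [Module R M]
    [AddCommGroup N] [Module R N] [AddCommGroup Q] [Module R Q]
    (f : M → N → Q) : M ⊗[R] N →ₗ[R] Q :=
  if h : ∃ F : M ⊗[R] N →ₗ[R] Q, ∀ x y, F (x ⊗ₜ[R] y) = f x y then h.choose else 0

/-- Choice-based lift of a (bilinear, balanced) function to a quotient of the tensor product. -/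
def qtlift (R : Type*) [CommRing R] {M N Q : Type*} [AddCommGroup M] [Module R M]
    [AddCommGroup N] [Module R N] [AddCommGroup Q] [Module R Q]
    (p : Submodule R (M ⊗[R] N)) (f : M → N → Q) : ((M ⊗[R] N) ⧸ p) →ₗ[R] Q :=
  if h : ∃ F : ((M ⊗[R] N) ⧸ p) →ₗ[R] Q,
      ∀ x y, F (Submodule.Quotient.mk (x ⊗ₜ[R] y)) = f x y then h.choose else 0

variable (k : Type*) [Field k]

/-- Source and target data for a left bialgebroid over `B`: an algebra map `s : B → L` and an
anti-algebra map `t : B → L` with commuting ranges. -/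
structure BgdST (B L : Type*) [Ring B] [Algebra k B] [Ring L] [Algebra k L] where
  s : B →ₐ[k] L
  t : B →ₗ[k] L
  t_one : t 1 = 1
  t_mul : ∀ a b : B, t (a * b) = t b * t a
  st_comm : ∀ a b : B, s a * t b = t b * s a

namespace BgdST

variable {k} {B L : Type*} [Ring B] [Algebra k B] [Ring L] [Algebra k L]
variable (st : BgdST k B L)

/-- The relations defining `L ⊗_B L`: `t a · X ⊗ Y  ~  X ⊗ s a · Y`. -/
def rel : Submodule k (L ⊗[k] L) :=
  Submodule.span k {z | ∃ (a : B) (X Y : L), z = (st.t a * X) ⊗ₜ[k] Y - X ⊗ₜ[k] (st.s a * Y)}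

/-- `L ⊗_B L` (the coring tensor square). -/
abbrev T2 := (L ⊗[k] L) ⧸ st.rel

/-- Class of a pure tensor in `L ⊗_B L`. -/
def mk2 (X Y : L) : st.T2 := Submodule.Quotient.mk (X ⊗ₜ[k] Y)

/-- Evaluate a balanced bilinear expression on an element of `L ⊗_B L`. -/
def lift2 {Q : Type*} [AddCommGroup Q] [Module k Q] (f : L → L → Q) : st.T2 →ₗ[k] Q :=
  qtlift k st.rel f

/-- The relations defining `L ⊗_{B^{op}} L`: `X·t a ⊗ Y ~ X ⊗ t a · Y`. -/
def relOp : Submodule k (L ⊗[k] L) :=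
  Submodule.span k {z | ∃ (a : B) (X Y : L), z = (X * st.t a) ⊗ₜ[k] Y - X ⊗ₜ[k] (st.t a * Y)}

/-- `L ⊗_{B^{op}} L` (domain of the canonical map `λ`). -/
abbrev TOp := (L ⊗[k] L) ⧸ st.relOp

def mkOp (X Y : L) : st.TOp := Submodule.Quotient.mk (X ⊗ₜ[k] Y)

def liftOp {Q : Type*} [AddCommGroup Q] [Module k Q] (f : L → L → Q) : st.TOp →ₗ[k] Q :=
  qtlift k st.relOp f

/-- The relations defining `L ⊗^{B^{op}} L`: `s a · X ⊗ Y ~ X ⊗ Y · s a`. -/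
def relA : Submodule k (L ⊗[k] L) :=
  Submodule.span k {z | ∃ (a : B) (X Y : L), z = (st.s a * X) ⊗ₜ[k] Y - X ⊗ₜ[k] (Y * st.s a)}

/-- `L ⊗^{B^{op}} L` (domain of the canonical map `μ`). -/
abbrev TA := (L ⊗[k] L) ⧸ st.relA

def mkA (X Y : L) : st.TA := Submodule.Quotient.mk (X ⊗ₜ[k] Y)

def liftA {Q : Type*} [AddCommGroup Q] [Module k Q] (f : L → L → Q) : st.TA →ₗ[k] Q :=
  qtlift k st.relA f

/-- Relations for the triple tensor `L ⊗_B L ⊗_B L`. -/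
def rel3 : Submodule k (L ⊗[k] (L ⊗[k] L)) :=
  Submodule.span k
    ({z | ∃ (a : B) (X Y Z : L),
        z = (st.t a * X) ⊗ₜ[k] (Y ⊗ₜ[k] Z) - X ⊗ₜ[k] ((st.s a * Y) ⊗ₜ[k] Z)} ∪
     {z | ∃ (a : B) (X Y Z : L),
        z = X ⊗ₜ[k] ((st.t a * Y) ⊗ₜ[k] Z) - X ⊗ₜ[k] (Y ⊗ₜ[k] (st.s a * Z))})

/-- `L ⊗_B L ⊗_B L`. -/
abbrev T3 := (L ⊗[k] (L ⊗[k] L)) ⧸ st.rel3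

def mk3 (X Y Z : L) : st.T3 := Submodule.Quotient.mk (X ⊗ₜ[k] (Y ⊗ₜ[k] Z))

/-- The factorwise product of two elements of `L ⊗_B L`, whenever it is well defined
on representatives (as it is when the left factor lies in the Takeuchi product);
junk value `0` otherwise. -/
def mulT2 (z w : st.T2) : st.T2 :=
  if h : ∃ u : st.T2, ∀ zr wr : L ⊗[k] L, Submodule.Quotient.mk zr = z →
      Submodule.Quotient.mk wr = w → Submodule.Quotient.mk (zr * wr) = u
  then h.choose else 0

variable (cop : L →ₗ[k] st.T2) (cou : L →ₗ[k] B)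

/-- The axioms of a left bialgebroid over `B` with structure `(s,t,Δ,ε) = (st.s, st.t, cop, cou)`
(Definition 2.3 of the paper): `L` is a `B^e`-ring and a `B`-coring, the coproduct corestricts
to an algebra map into the Takeuchi product, and the counit is a left character. -/
structure IsLeftBialgebroid : Prop where
  comul_one : cop 1 = st.mk2 1 1
  comul_mul : ∀ X Y : L, cop (X * Y) = st.mulT2 (cop X) (cop Y)
  comul_s : ∀ (b : B) (X : L),
    cop (st.s b * X) = st.lift2 (fun x y => st.mk2 (st.s b * x) y) (cop X)
  comul_t : ∀ (b : B) (X : L),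
    cop (st.t b * X) = st.lift2 (fun x y => st.mk2 x (st.t b * y)) (cop X)
  takeuchi : ∀ (b : B) (X : L),
    st.lift2 (fun x y => st.mk2 (x * st.t b) y) (cop X) =
      st.lift2 (fun x y => st.mk2 x (y * st.s b)) (cop X)
  coassoc : ∀ X : L,
    st.lift2 (fun x1 x2 => st.lift2 (fun y1 y2 => st.mk3 x1 y1 y2) (cop x2)) (cop X) =
      st.lift2 (fun x12 x3 => st.lift2 (fun x1 x2 => st.mk3 x1 x2 x3) (cop x12)) (cop X)
  counit_comul_left : ∀ X : L, st.lift2 (fun x1 x2 => st.s (cou x1) * x2) (cop X) = X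
  counit_comul_right : ∀ X : L, st.lift2 (fun x1 x2 => st.t (cou x2) * x1) (cop X) = X
  counit_one : cou 1 = 1
  counit_s : ∀ (b : B) (X : L), cou (st.s b * X) = b * cou X
  counit_t : ∀ (b : B) (X : L), cou (st.t b * X) = cou X * b
  counit_char_s : ∀ X Y : L, cou (X * st.s (cou Y)) = cou (X * Y)
  counit_char_t : ∀ X Y : L, cou (X * st.t (cou Y)) = cou (X * Y)

/-- The canonical map `λ : L ⊗_{B^{op}} L → L ⊗_B L`, `X ⊗ Y ↦ X₍₁₎ ⊗ X₍₂₎Y`. -/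
def lam : st.TOp →ₗ[k] st.T2 :=
  st.liftOp (fun X Y => st.lift2 (fun x1 x2 => st.mk2 x1 (x2 * Y)) (cop X))

/-- A left bialgebroid is a left Hopf algebroid if `λ` is bijective. -/
def IsLeftHopf : Prop := Function.Bijective (st.lam cop)

/-- The canonical map `μ : L ⊗^{B^{op}} L → L ⊗_B L`, `X ⊗ Y ↦ Y₍₁₎X ⊗ Y₍₂₎`. -/
def mu : st.TA →ₗ[k] st.T2 :=
  st.liftA (fun X Y => st.lift2 (fun y1 y2 => st.mk2 (y1 * X) y2) (cop Y))

/-- A left bialgebroid is an anti-left Hopf algebroid if `μ` is bijective. -/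
def IsAntiLeftHopf : Prop := Function.Bijective (st.mu cop)

/-- `X₊ ⊗_{B^{op}} X₋ := λ⁻¹(X ⊗_B 1)` (meaningful when `λ` is bijective). -/
def plusMinus (X : L) : st.TOp := Function.invFun (st.lam cop) (st.mk2 X 1)

/-- `X₍₋₎ ⊗^{B^{op}} X₍₊₎ := μ⁻¹(1 ⊗_B X)` (meaningful when `μ` is bijective). -/
def minusPlus (X : L) : st.TA := Function.invFun (st.mu cop) (st.mk2 1 X)

/-- A left bisection of a left bialgebroid (Definition 3.1). -/
structure IsLeftBisection (σ : L →ₗ[k] B) : Prop where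
  unital : σ 1 = 1
  t_prop : ∀ (b : B) (X : L), σ (st.t b * X) = σ X * b
  s_mul : ∀ a b : B, σ (st.s (a * b)) = σ (st.s a) * σ (st.s b)
  s_bij : Function.Bijective (fun b => σ (st.s b))
  prod_t : ∀ X Y : L, σ (X * Y) = σ (X * st.t (σ Y))
  prod_s : ∀ X Y : L,
    σ (X * Y) = σ (X * st.s (Function.invFun (fun b => σ (st.s b)) (σ Y)))

/-- Convolution of left bisections:  `(σ * η)(X) := σ(s(η(X₍₁₎)) X₍₂₎)`. -/
def bconv (σ η : L →ₗ[k] B) : L →ₗ[k] B :=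
  (st.lift2 (fun x1 x2 => σ (st.s (η x1) * x2))).comp cop

/-- A right bisection of a left bialgebroid (Definition 3.6). -/
structure IsRightBisection (σ : L →ₗ[k] B) : Prop where
  unital : σ 1 = 1
  s_prop : ∀ (b : B) (X : L), σ (st.s b * X) = b * σ X
  t_mul : ∀ a b : B, σ (st.t (a * b)) = σ (st.t b) * σ (st.t a)
  t_bij : Function.Bijective (fun b => σ (st.t b))
  prod_s : ∀ X Y : L, σ (X * Y) = σ (X * st.s (σ Y))
  prod_t : ∀ X Y : L,
    σ (X * Y) = σ (X * st.t (Function.invFun (fun b => σ (st.t b)) (σ Y)))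

/-- Convolution of right bisections:  `(σ • η)(X) := σ(t(η(X₍₂₎)) X₍₁₎)`. -/
def rconv (σ η : L →ₗ[k] B) : L →ₗ[k] B :=
  (st.lift2 (fun x1 x2 => σ (st.t (η x2) * x1))).comp cop

/-- An automorphism `(Φ, φ)` of a left bialgebroid. -/
structure IsBgdAut (Φ : L →ₐ[k] L) (φ : B →ₐ[k] B) : Prop where
  bijL : Function.Bijective Φ
  bijB : Function.Bijective φ
  comp_s : ∀ b : B, Φ (st.s b) = st.s (φ b)
  comp_t : ∀ b : B, Φ (st.t b) = st.t (φ b)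
  comp_comul : ∀ X : L,
    cop (Φ X) = st.lift2 (fun x1 x2 => st.mk2 (Φ x1) (Φ x2)) (cop X)
  comp_counit : ∀ X : L, cou (Φ X) = φ (cou X)

/-- `Ad^L_σ(X) := s(σ(X₍₁₎)) X₍₂₎₊ t(σ(X₍₂₎₋))`, for a left Hopf algebroid. -/
def adL (σ : L →ₗ[k] B) (X : L) : L :=
  st.lift2 (fun x1 x2 => st.s (σ x1) *
    st.liftOp (fun p m => p * st.t (σ m)) (st.plusMinus cop x2)) (cop X)

/-- `Ad^R_σ(X) := t(σ(X₍₂₎)) X₍₁₎₍₊₎ s(σ(X₍₁₎₍₋₎))`, for an anti-left Hopf algebroid. -/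
def adR (σ : L →ₗ[k] B) (X : L) : L :=
  st.lift2 (fun x1 x2 => st.t (σ x2) *
    st.liftA (fun m p => p * st.s (σ m)) (st.minusPlus cop x1)) (cop X)

/-- The `B`-bimodule-map conditions on a map `L → B` used for `C¹(L,B)`. -/
def IsBimodMap (U : L →ₗ[k] B) : Prop :=
  (∀ (b : B) (X : L), U (st.t b * X) = U X * b) ∧
  (∀ (b : B) (X : L), U (st.s b * X) = b * U X)

/-- Convolution `(U * V)(X) = U(X₍₁₎) V(X₍₂₎)` of `B`-valued maps. -/
def cconv (U V : L →ₗ[k] B) : L →ₗ[k] B :=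
  (st.lift2 (fun x1 x2 => U x1 * V x2)).comp cop

/-- Extended vertical bisections `C¹(L,B)`: unital convolution-invertible `B`-bimodule maps
`U : L → B` with `U(X s(b)) = U(X t(b))`. -/
def IsC1 (U : L →ₗ[k] B) : Prop :=
  U 1 = 1 ∧ st.IsBimodMap U ∧
  (∀ (b : B) (X : L), U (X * st.s b) = U (X * st.t b)) ∧
  ∃ V : L →ₗ[k] B, st.IsBimodMap V ∧ st.cconv cop U V = cou ∧ st.cconv cop V U = cou

/-- Convolution product on `B`-bimodule maps `L ⊗_{B^e} L → B`:
`(f ⋆ g)(X,Y) = f(X₍₁₎,Y₍₁₎) g(X₍₂₎,Y₍₂₎)`. -/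
def conv2 (f g : L → L → B) (X Y : L) : B :=
  st.lift2 (fun y1 y2 =>
    st.lift2 (fun x1 x2 => f x1 y1 * g x2 y2) (cop X)) (cop Y)

/-- The unit `ε̃(X ⊗ Y) = ε(XY)` of the convolution algebra. -/
def unit2 (X Y : L) : B := cou (X * Y)

/-- Left-hand side of the 2-cocycle condition: `Γ(X, s(Γ(Y₍₁₎,Z₍₁₎)) Y₍₂₎Z₍₂₎)`. -/
def cocL (Γ : L → L → B) (X Y Z : L) : B :=
  st.lift2 (fun z1 z2 =>
    st.lift2 (fun y1 y2 => Γ X (st.s (Γ y1 z1) * (y2 * z2))) (cop Y)) (cop Z)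

/-- Right-hand side of the 2-cocycle condition: `Γ(s(Γ(X₍₁₎,Y₍₁₎)) X₍₂₎Y₍₂₎, Z)`. -/
def cocR (Γ : L → L → B) (X Y Z : L) : B :=
  st.lift2 (fun y1 y2 =>
    st.lift2 (fun x1 x2 => Γ (st.s (Γ x1 y1) * (x2 * y2)) Z) (cop X)) (cop Y)

/-- Membership of a bilinear map in `_B Hom_B (L ⊗_{B^e} L, B)`. -/
def IsBihom (Γ : L → L → B) : Prop :=
  (∃ Γ' : L →ₗ[k] L →ₗ[k] B, ∀ X Y, Γ' X Y = Γ X Y) ∧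
  (∀ (b c : B) (X Y : L), Γ (st.s b * (st.t c * X)) Y = b * Γ X Y * c) ∧
  (∀ (b c : B) (X Y : L), Γ (X * st.s b * st.t c) Y = Γ X (st.s b * (st.t c * Y)))

/-- An invertible normalised 2-cocycle on a left bialgebroid (Definition 2.6);
the collection of these is `Z²(L,B)`. -/
structure IsZ2 (Γ : L → L → B) : Prop where
  bihom : st.IsBihom Γ
  norm_left : ∀ X : L, Γ 1 X = cou X
  norm_right : ∀ X : L, Γ X 1 = cou X
  st_indep : ∀ (b : B) (X Y : L), Γ X (Y * st.s b) = Γ X (Y * st.t b)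
  cocycle : ∀ X Y Z : L, st.cocL cop Γ X Y Z = st.cocR cop Γ X Y Z
  inv : ∃ Γi : L → L → B, st.IsBihom Γi ∧
    (∀ X Y, st.conv2 cop Γ Γi X Y = unit2 cou X Y) ∧
    (∀ X Y, st.conv2 cop Γi Γ X Y = unit2 cou X Y)

/-- The coboundary `∂U(X,Y) = U⁻¹(X₍₁₎ t(U⁻¹(Y₍₁₎))) U(X₍₂₎Y₍₂₎)` of `U ∈ C¹(L,B)`. -/
def coboundary (U Ui : L →ₗ[k] B) (X Y : L) : B :=
  st.lift2 (fun y1 y2 =>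
    st.lift2 (fun x1 x2 => Ui (x1 * st.t (Ui y1)) * U (x2 * y2)) (cop X)) (cop Y)

/-- The transform `Γ^U(X,Y) = U⁻¹(X₍₁₎ t(U⁻¹(Y₍₁₎))) Γ(X₍₂₎,Y₍₂₎) U(X₍₃₎Y₍₃₎)`. -/
def gammaU (Γ : L → L → B) (U Ui : L →ₗ[k] B) (X Y : L) : B :=
  st.lift2 (fun y1 y23 => st.lift2 (fun y2 y3 =>
    st.lift2 (fun x1 x23 => st.lift2 (fun x2 x3 =>
      Ui (x1 * st.t (Ui y1)) * Γ x2 y2 * U (x3 * y3)) (cop x23)) (cop X))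
    (cop y23)) (cop Y)

/-- The cotwisted product `X ·_Γ Y := s(Γ(X₍₁₎,Y₍₁₎)) t(Γ⁻¹(X₍₃₎,Y₍₃₎)) X₍₂₎Y₍₂₎`. -/
def prodG (Γ Γi : L → L → B) (X Y : L) : L :=
  st.lift2 (fun y1 y23 => st.lift2 (fun y2 y3 =>
    st.lift2 (fun x1 x23 => st.lift2 (fun x2 x3 =>
      st.s (Γ x1 y1) * (st.t (Γi x3 y3) * (x2 * y2))) (cop x23)) (cop X))
    (cop y23)) (cop Y)

/-- `Ad_U(X) := s(U(X₍₁₎)) t(U⁻¹(X₍₃₎)) X₍₂₎`. -/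
def adU (U Ui : L →ₗ[k] B) (X : L) : L :=
  st.lift2 (fun x1 x23 => st.lift2 (fun x2 x3 =>
    st.s (U x1) * (st.t (Ui x3) * x2)) (cop x23)) (cop X)

end BgdST

end

/-! ## Crossed (Drinfeld–Yetter) module algebras and action Hopf algebroids -/

noncomputable section
attribute [local instance] Classical.propDecidable

universe u v

open scoped TensorProduct
open TensorProduct

variable {k : Type u} [Field k] {H : Type v} [Ring H] [HopfAlgebra k H]
  {B : Type v} [Ring B] [Algebra k B]

/-- A right-right `H`-crossed (Drinfeld–Yetter) module algebra structure on `B`, given by a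
right action `act` and a right coaction `coact`. -/
def IsRRCrossed (act : B → H → B) (coact : B → B ⊗[k] H) : Prop :=
  (∃ act' : B →ₗ[k] H →ₗ[k] B, ∀ (b : B) (h : H), act' b h = act b h) ∧
  (∃ coact' : B →ₗ[k] B ⊗[k] H, ∀ b : B, coact' b = coact b) ∧
  (∀ b : B, act b 1 = b) ∧
  (∀ (b : B) (g h : H), act (act b g) h = act b (g * h)) ∧
  (∀ h : H, act 1 h = algebraMap k B (Coalgebra.counit (R := k) h)) ∧
  (∀ (a b : B) (h : H), act (a * b) h =
    tlift k (fun h1 h2 => act a h1 * act b h2) (Coalgebra.comul (R := k) h)) ∧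
  (coact 1 = 1) ∧
  (∀ a b : B, coact (a * b) = coact a * coact b) ∧
  (∀ b : B,
    tlift k (fun b0 b1 => (b0 ⊗ₜ[k] (Coalgebra.comul (R := k) b1) : B ⊗[k] (H ⊗[k] H)))
      (coact b) =
    tlift k (fun b0 b1 => tlift k (fun c0 c1 => (c0 ⊗ₜ[k] (c1 ⊗ₜ[k] b1) : B ⊗[k] (H ⊗[k] H)))
      (coact b0)) (coact b)) ∧
  (∀ b : B, tlift k (fun b0 b1 => (Coalgebra.counit (R := k) b1 : k) • b0) (coact b) = b) ∧
  -- the Drinfeld–Yetter compatibility  (a ◁ h₂)₀ ⊗ h₁(a ◁ h₂)₁ = (a₀ ◁ h₁) ⊗ a₁h₂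
  (∀ (a : B) (h : H),
    tlift k (fun h1 h2 => tlift k (fun c0 c1 => c0 ⊗ₜ[k] (h1 * c1)) (coact (act a h2)))
      (Coalgebra.comul (R := k) h) =
    tlift k (fun b0 b1 => tlift k (fun h1 h2 => act b0 h1 ⊗ₜ[k] (b1 * h2))
      (Coalgebra.comul (R := k) h)) (coact a))

/-- Braided commutativity `a b = b₀ (a ◁ b₁)`. -/
def IsBraidedComm (act : B → H → B) (coact : B → B ⊗[k] H) : Prop :=
  ∀ a b : B, a * b = tlift k (fun b0 b1 => b0 * act a b1) (coact b)

/-- The smash product multiplication `(a # h)(b # g) = a (b ◁ h₁) # g h₂` on `B ⊗ H`. -/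
def smashMul (act : B → H → B) (z w : B ⊗[k] H) : B ⊗[k] H :=
  tlift k (fun a h => tlift k (fun b g => tlift k (fun h1 h2 =>
    (a * act b h1) ⊗ₜ[k] (g * h2)) (Coalgebra.comul (R := k) h)) w) z

/-- `ψ(b) = b₀ ϱ(b₁)` for `ϱ : H → B`. -/
def psiFun (coact : B → B ⊗[k] H) (ϱ : H → B) (b : B) : B :=
  tlift k (fun b0 b1 => b0 * ϱ b1) (coact b)

/-- `Z¹_◁(H,B)`: unital maps `ϱ : H → B` with `ϱ(gh) = (ϱ(g) ◁ h₁) ϱ(h₂)` and `ψ` bijective. -/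
def IsZ1cross (act : B → H → B) (coact : B → B ⊗[k] H) (ϱ : H →ₗ[k] B) : Prop :=
  ϱ 1 = 1 ∧
  (∀ g h : H, ϱ (g * h) =
    tlift k (fun h1 h2 => act (ϱ g) h1 * ϱ h2) (Coalgebra.comul (R := k) h)) ∧
  Function.Bijective (psiFun coact (⇑ϱ))

/-- The group product `(ϱ • ϱ')(h) = ϱ(h₁) ψ(ϱ'(h₂))` on `Z¹_◁(H,B)`. -/
def bulletFun (coact : B → B ⊗[k] H) (ϱ ϱ' : H → B) (h : H) : B :=
  tlift k (fun h1 h2 => ϱ h1 * psiFun coact ϱ (ϱ' h2)) (Coalgebra.comul (R := k) h)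

/-- The unit `h ↦ ε(h)1`. -/
def unitBmap : H →ₗ[k] B :=
  (Algebra.linearMap k B).comp (Coalgebra.counit (R := k) (A := H))

/-- Convolution of linear maps `H → B`. -/
def convHB (f g : H →ₗ[k] B) : H →ₗ[k] B :=
  (tlift k (fun h1 h2 => f h1 * g h2)).comp (Coalgebra.comul (R := k) (A := H))

/-- Convolution of maps `H ⊗ H → B`. -/
def convBB (γ δ : H → H → B) (h g : H) : B :=
  tlift k (fun h1 h2 => tlift k (fun g1 g2 => γ h1 g1 * δ h2 g2)
    (Coalgebra.comul (R := k) g)) (Coalgebra.comul (R := k) h)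

/-- `Z²_{◁,as}(H,B)`: convolution-invertible 2-cocycles of associative type. -/
def IsZ2as (act : B → H → B) (γ : H → H → B) : Prop :=
  (∃ γ' : H →ₗ[k] H →ₗ[k] B, ∀ h g, γ' h g = γ h g) ∧
  (∀ h : H, γ h 1 = algebraMap k B (Coalgebra.counit (R := k) h) ∧
    γ 1 h = algebraMap k B (Coalgebra.counit (R := k) h)) ∧
  (∀ h g f : H,
    tlift k (fun h1 h2 => tlift k (fun g1 g2 => tlift k (fun f1 f2 =>
      act (γ g1 f1) h1 * γ h2 (f2 * g2)) (Coalgebra.comul (R := k) f))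
        (Coalgebra.comul (R := k) g)) (Coalgebra.comul (R := k) h) =
    tlift k (fun h1 h2 => tlift k (fun g1 g2 =>
      γ h1 g1 * γ (g2 * h2) f) (Coalgebra.comul (R := k) g)) (Coalgebra.comul (R := k) h)) ∧
  (∀ (h g : H) (b : B),
    tlift k (fun h1 h2 => tlift k (fun g1 g2 => γ h1 g1 * act b (g2 * h2))
      (Coalgebra.comul (R := k) g)) (Coalgebra.comul (R := k) h) =
    tlift k (fun h1 h2 => tlift k (fun g1 g2 => act b (g1 * h1) * γ h2 g2)
      (Coalgebra.comul (R := k) g)) (Coalgebra.comul (R := k) h)) ∧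
  (∃ γi : H → H → B, (∃ γi' : H →ₗ[k] H →ₗ[k] B, ∀ h g, γi' h g = γi h g) ∧
    (∀ h g : H, convBB (k := k) γ γi h g =
      algebraMap k B (Coalgebra.counit (R := k) h * Coalgebra.counit (R := k) g)) ∧
    (∀ h g : H, convBB (k := k) γi γ h g =
      algebraMap k B (Coalgebra.counit (R := k) h * Coalgebra.counit (R := k) g)))

/-- `Z²_◁(H,B)`: the subset of `Z²_{◁,as}(H,B)` satisfying the two extra conditions. -/
def IsZ2cross (act : B → H → B) (coact : B → B ⊗[k] H) (γ : H → H → B) : Prop :=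
  IsZ2as (k := k) act γ ∧
  (∀ (h g : H) (c : B),
    tlift k (fun h1 h2 => γ h1 g * act c h2) (Coalgebra.comul (R := k) h) =
    tlift k (fun c0 c1 => tlift k (fun h1 h2 => act c0 h1 * γ h2 (g * c1))
      (Coalgebra.comul (R := k) h)) (coact c)) ∧
  (∀ (h g : H) (c : B),
    tlift k (fun c0 c1 => c0 * γ (h * c1) g) (coact c) = γ h g * c)

/-- `C¹_{◁,ver}(H,B)`: unital convolution-invertible maps `ϱ : H → B` with
`b₀ ϱ(h b₁) = ϱ(h) b` and `ϱ(h₁)(b ◁ h₂) = (b ◁ h₁) ϱ(h₂)`. -/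
def IsC1ver (act : B → H → B) (coact : B → B ⊗[k] H) (ϱ : H →ₗ[k] B) : Prop :=
  ϱ 1 = 1 ∧
  (∀ (h : H) (b : B), tlift k (fun b0 b1 => b0 * ϱ (h * b1)) (coact b) = ϱ h * b) ∧
  (∀ (h : H) (b : B),
    tlift k (fun h1 h2 => ϱ h1 * act b h2) (Coalgebra.comul (R := k) h) =
    tlift k (fun h1 h2 => act b h1 * ϱ h2) (Coalgebra.comul (R := k) h)) ∧
  ∃ ϱi : H →ₗ[k] B, convHB ϱ ϱi = unitBmap ∧ convHB ϱi ϱ = unitBmap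

/-- `γ^ϱ(h,g) = ϱ⁻¹(h₁)(ϱ⁻¹(g₁) ◁ h₂) γ(h₃, g₂) ϱ(g₃ h₄)`. -/
def gamRho (act : B → H → B) (ϱ ϱi : H → B) (γ : H → H → B) (h g : H) : B :=
  tlift k (fun h1 h234 => tlift k (fun h2 h34 => tlift k (fun h3 h4 =>
    tlift k (fun g1 g23 => tlift k (fun g2 g3 =>
      ϱi h1 * act (ϱi g1) h2 * γ h3 g2 * ϱ (g3 * h4)) (Coalgebra.comul (R := k) g23))
      (Coalgebra.comul (R := k) g))
    (Coalgebra.comul (R := k) h34)) (Coalgebra.comul (R := k) h234))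
    (Coalgebra.comul (R := k) h)

/-- The value `Γ_γ(a # h, b # g) = a (b ◁ h₁) γ(h₂, g)` computed through `ψ`. -/
def gammaSmash {L0 : Type v} [AddCommGroup L0] [Module k L0]
    (act : B → H → B) (ψ : L0 ≃ₗ[k] B ⊗[k] H) (γ : H → H → B) (z w : L0) : B :=
  tlift k (fun a h => tlift k (fun b g => tlift k (fun h1 h2 =>
    a * act b h1 * γ h2 g) (Coalgebra.comul (R := k) h)) (ψ w)) (ψ z)

end

open Coalgebra (comul counit)

noncomputable section

/-- `k`-linearity of an unbundled function, as a `fun_prop` predicate. -/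
@[fun_prop]
structure Lin (k : Type*) [Field k] {M N : Type*} [AddCommGroup M] [Module k M]
    [AddCommGroup N] [Module k N] (f : M → N) : Prop where
  map_add : ∀ x y, f (x + y) = f x + f y
  map_smul : ∀ (c : k) x, f (c • x) = c • f x

section TensorLift

variable {k : Type*} [Field k] {M N P Q R A : Type*} [AddCommGroup M] [Module k M]
  [AddCommGroup N] [Module k N] [AddCommGroup P] [Module k P] [AddCommGroup Q] [Module k Q]
  [AddCommGroup R] [Module k R] [Ring A] [Algebra k A]

namespace Lin

@[fun_prop]
theorem id : Lin k (fun x : M => x) := ⟨fun _ _ => rfl, fun _ _ => rfl⟩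

@[fun_prop]
theorem comp {f : N → P} {g : M → N} (hf : Lin k f) (hg : Lin k g) :
    Lin k (fun x => f (g x)) :=
  ⟨by simp [hf.map_add, hg.map_add], by simp [hf.map_smul, hg.map_smul]⟩

@[fun_prop]
theorem add {f g : M → N} (hf : Lin k f) (hg : Lin k g) : Lin k (fun x => f x + g x) :=
  ⟨fun x y => by rw [hf.map_add, hg.map_add]; abel, by simp [hf.map_smul, hg.map_smul]⟩

@[fun_prop]
theorem linearMap (F : N →ₗ[k] P) {g : M → N} (hg : Lin k g) : Lin k (fun x => F (g x)) :=
  ⟨by simp [hg.map_add], by simp [hg.map_smul]⟩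

@[fun_prop]
theorem linearEquiv (F : N ≃ₗ[k] P) {g : M → N} (hg : Lin k g) : Lin k (fun x => F (g x)) :=
  ⟨by simp [hg.map_add], by simp [hg.map_smul]⟩

@[fun_prop]
theorem linearMap₂ (F : N →ₗ[k] P →ₗ[k] Q) {g : M → N} (hg : Lin k g) (c : P) :
    Lin k (fun x => F (g x) c) :=
  ⟨by simp [hg.map_add], by simp [hg.map_smul]⟩

@[fun_prop]
theorem algHom {A' : Type*} [Ring A'] [Algebra k A'] (F : A →ₐ[k] A') {g : M → A}
    (hg : Lin k g) : Lin k (fun x => F (g x)) :=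
  ⟨by simp [hg.map_add], by simp [hg.map_smul]⟩

@[fun_prop]
theorem mul_const {g : M → A} (hg : Lin k g) (c : A) : Lin k (fun x => g x * c) :=
  ⟨by simp [hg.map_add, add_mul], by simp [hg.map_smul]⟩

@[fun_prop]
theorem const_mul {g : M → A} (hg : Lin k g) (c : A) : Lin k (fun x => c * g x) :=
  ⟨by simp [hg.map_add, mul_add], by simp [hg.map_smul]⟩

@[fun_prop]
theorem smul_const {g : M → k} (hg : Lin k g) (c : N) : Lin k (fun x => g x • c) :=
  ⟨by simp [hg.map_add, add_smul], by simp [hg.map_smul, mul_smul]⟩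

@[fun_prop]
theorem const_smul {g : M → N} (hg : Lin k g) (c : k) : Lin k (fun x => c • g x) :=
  ⟨by simp [hg.map_add], fun d x => by rw [hg.map_smul, smul_comm]⟩

@[fun_prop]
theorem tmul_const {g : M → N} (hg : Lin k g) (c : P) : Lin k (fun x => g x ⊗ₜ[k] c) :=
  ⟨by simp [hg.map_add, TensorProduct.add_tmul], by simp [hg.map_smul, TensorProduct.smul_tmul']⟩

@[fun_prop]
theorem const_tmul {g : M → N} (hg : Lin k g) (c : P) : Lin k (fun x => c ⊗ₜ[k] g x) :=
  ⟨by simp [hg.map_add, TensorProduct.tmul_add], by simp [hg.map_smul]⟩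

/-- The linear map underlying a `Lin` function. -/
def toLinearMap {f : M → N} (hf : Lin k f) : M →ₗ[k] N where
  toFun := f
  map_add' := hf.map_add
  map_smul' := hf.map_smul

theorem map_zero {f : M → N} (hf : Lin k f) : f 0 = 0 := hf.toLinearMap.map_zero

end Lin

/-- The bilinear map underlying a function that is linear in each argument. -/
def bilinOfLin {f : M → N → P} (h₁ : ∀ y, Lin k fun x => f x y) (h₂ : ∀ x, Lin k fun y => f x y) :
    M →ₗ[k] N →ₗ[k] P :=
  LinearMap.mk₂ k f (fun _ _ y => (h₁ y).map_add _ _) (fun _ _ y => (h₁ y).map_smul _ _)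
    (fun x => (h₂ x).map_add) (fun c x => (h₂ x).map_smul c)

theorem bilinOfLin_apply {f : M → N → P} (h₁ : ∀ y, Lin k fun x => f x y)
    (h₂ : ∀ x, Lin k fun y => f x y) (x : M) (y : N) : bilinOfLin h₁ h₂ x y = f x y := rfl

theorem tlift_tmul {f : M → N → P} (x : M) (y : N)
    (h₁ : ∀ y, Lin k fun x => f x y := by fun_prop)
    (h₂ : ∀ x, Lin k fun y => f x y := by fun_prop) :
    tlift k f (x ⊗ₜ[k] y) = f x y := by
  have h : ∃ F : M ⊗[k] N →ₗ[k] P, ∀ x y, F (x ⊗ₜ[k] y) = f x y :=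
    ⟨TensorProduct.lift (bilinOfLin h₁ h₂), fun _ _ => by simp [bilinOfLin_apply]⟩
  unfold tlift
  rw [dif_pos h]
  exact h.choose_spec x y

theorem lin_apply_tlift {f : M → N → P} {φ : P → Q} (hφ : Lin k φ) (z : M ⊗[k] N)
    (h₁ : ∀ y, Lin k fun x => f x y := by fun_prop)
    (h₂ : ∀ x, Lin k fun y => f x y := by fun_prop) :
    φ (tlift k f z) = tlift k (fun x y => φ (f x y)) z := by
  induction z with
  | zero => simp [hφ.map_zero]
  | tmul x y => rw [tlift_tmul, tlift_tmul]
  | add x y hx hy => simp [hφ.map_add, hx, hy]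

@[fun_prop]
theorem Lin.tlift_fun {f : M → N → P → Q} (z : N ⊗[k] P)
    (h₁ : ∀ b c, Lin k (fun a => f a b c)) (h₂ : ∀ a c, Lin k (fun b => f a b c))
    (h₃ : ∀ a b, Lin k (fun c => f a b c)) : Lin k (fun a => tlift k (f a) z) := by
  constructor
  · intro x y
    induction z with
    | zero => simp
    | tmul b c => rw [tlift_tmul, tlift_tmul, tlift_tmul, (h₁ b c).map_add]
    | add v w hv hw => rw [_root_.map_add, _root_.map_add, _root_.map_add, hv, hw]; abel
  · intro r x
    induction z with
    | zero => simp
    | tmul b c => rw [tlift_tmul, tlift_tmul, (h₁ b c).map_smul]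
    | add v w hv hw => rw [_root_.map_add, _root_.map_add, hv, hw, smul_add]

@[fun_prop]
theorem Lin.tlift_arg (f : N → P → Q) {g : M → N ⊗[k] P} (hg : Lin k g) :
    Lin k (fun a => tlift k f (g a)) := .linearMap _ hg

theorem Lin.tensor_ext {f g : M ⊗[k] N → P} (hf : Lin k f) (hg : Lin k g)
    (h : ∀ x y, f (x ⊗ₜ y) = g (x ⊗ₜ y)) : ∀ z : M ⊗[k] N, f z = g z := by
  intro z
  induction z with
  | zero => rw [hf.map_zero, hg.map_zero]
  | tmul x y => exact h x y
  | add x y hx hy => rw [hf.map_add, hg.map_add, hx, hy]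

theorem tlift_comm {f : M → N → P → Q → R} (z : M ⊗[k] N) (w : P ⊗[k] Q)
    (h₁ : ∀ b c d, Lin k (fun a => f a b c d) := by fun_prop)
    (h₂ : ∀ a c d, Lin k (fun b => f a b c d) := by fun_prop)
    (h₃ : ∀ a b d, Lin k (fun c => f a b c d) := by fun_prop)
    (h₄ : ∀ a b c, Lin k (fun d => f a b c d) := by fun_prop) :
    tlift k (fun a b => tlift k (fun c d => f a b c d) w) z =
      tlift k (fun c d => tlift k (fun a b => f a b c d) z) w := by
  revert w
  refine Lin.tensor_ext (k := k) ?_ ?_ (fun c d => ?_) <;> try fun_prop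
  rw [tlift_tmul]
  congr 2
  exact funext₂ fun a b => tlift_tmul c d

end TensorLift

section Sweedler

variable {k : Type*} [Field k] {H Q : Type*} [Ring H] [HopfAlgebra k H] [AddCommGroup Q]
  [Module k Q]

theorem tlift_comul_one {f : H → H → Q} (h₁ : ∀ y, Lin k fun x => f x y := by fun_prop)
    (h₂ : ∀ x, Lin k fun y => f x y := by fun_prop) :
    tlift k f (comul (R := k) (1 : H)) = f 1 1 := by
  rw [Bialgebra.comul_one, Algebra.TensorProduct.one_def, tlift_tmul]

theorem tlift_coassoc {f : H → H → H → Q} (h : H)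
    (h₁ : ∀ b c, Lin k (fun a => f a b c) := by fun_prop)
    (h₂ : ∀ a c, Lin k (fun b => f a b c) := by fun_prop)
    (h₃ : ∀ a b, Lin k (fun c => f a b c) := by fun_prop) :
    tlift k (fun a b => tlift k (fun c d => f c d b) (comul (R := k) a)) (comul (R := k) h) =
      tlift k (fun a b => tlift k (fun c d => f a c d) (comul (R := k) b))
        (comul (R := k) h) := by
  have key := congrArg (tlift k (fun a w => tlift k (fun c d => f a c d) w))
    (Coalgebra.coassoc_apply (R := k) h)
  generalize comul (R := k) h = z at *
  refine Eq.trans ?_ (key.trans ?_) <;> clear key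
  · revert z
    refine Lin.tensor_ext (k := k) ?_ ?_ (fun a b => ?_) <;> try fun_prop
    rw [tlift_tmul, LinearMap.rTensor_tmul]
    generalize comul (R := k) a = w
    revert w
    refine Lin.tensor_ext (k := k) ?_ ?_ (fun c d => ?_) <;> try fun_prop
    rw [tlift_tmul, TensorProduct.assoc_tmul, tlift_tmul, tlift_tmul]
  · revert z
    refine Lin.tensor_ext (k := k) ?_ ?_ (fun a b => ?_) <;> try fun_prop
    rw [tlift_tmul, LinearMap.lTensor_tmul, tlift_tmul]

theorem tlift_counit_left {f : H → Q} (h : H) (hf : Lin k f := by fun_prop) :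
    tlift k (fun a b => counit (R := k) a • f b) (comul (R := k) h) = f h := by
  have key := congrArg (tlift k (fun (r : k) b => r • f b))
    (Coalgebra.rTensor_counit_comul (R := k) h)
  rw [tlift_tmul, one_smul] at key
  rw [← key]
  generalize comul (R := k) h = z
  revert z
  refine Lin.tensor_ext (k := k) ?_ ?_ (fun a b => ?_) <;> try fun_prop
  rw [tlift_tmul, LinearMap.rTensor_tmul, tlift_tmul]

end Sweedler

end

noncomputable section

namespace BgdST

variable {k : Type*} [Field k] {B L Q R : Type*} [Ring B] [Algebra k B] [Ring L] [Algebra k L]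
  [AddCommGroup Q] [Module k Q] [AddCommGroup R] [Module k R] {st : BgdST k B L}

/-- `f` is bilinear and `B`-balanced, hence factors through `L ⊗_B L`. -/
structure Bal (st : BgdST k B L) (f : L → L → Q) : Prop where
  left : ∀ y, Lin k fun x => f x y := by fun_prop
  right : ∀ x, Lin k fun y => f x y := by fun_prop
  bal : ∀ a x y, f (st.t a * x) y = f x (st.s a * y)

@[fun_prop]
theorem lin_mk2_left (y : L) {P : Type*} [AddCommGroup P] [Module k P] {g : P → L}
    (hg : Lin k g) : Lin k fun x => st.mk2 (g x) y :=
  .linearMap st.rel.mkQ (.tmul_const hg y)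

@[fun_prop]
theorem lin_mk2_right (x : L) {P : Type*} [AddCommGroup P] [Module k P] {g : P → L}
    (hg : Lin k g) : Lin k fun y => st.mk2 x (g y) :=
  .linearMap st.rel.mkQ (.const_tmul hg x)

theorem mk2_t_mul (a : B) (x y : L) : st.mk2 (st.t a * x) y = st.mk2 x (st.s a * y) := by
  unfold mk2
  rw [Submodule.Quotient.eq]
  exact Submodule.subset_span ⟨a, x, y, rfl⟩

theorem lift2_mk2 {f : L → L → Q} (hf : st.Bal f) (x y : L) :
    st.lift2 f (st.mk2 x y) = f x y := by
  have h : ∃ F : st.T2 →ₗ[k] Q,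
      ∀ x y, F (Submodule.Quotient.mk (x ⊗ₜ[k] y)) = f x y := by
    refine ⟨st.rel.liftQ (tlift k f) ?_, fun x y => ?_⟩
    · rw [rel, Submodule.span_le]
      rintro _ ⟨a, X, Y, rfl⟩
      rw [SetLike.mem_coe, LinearMap.mem_ker, map_sub, tlift_tmul _ _ hf.left hf.right,
        tlift_tmul _ _ hf.left hf.right, hf.bal, sub_self]
    · rw [Submodule.liftQ_apply, tlift_tmul _ _ hf.left hf.right]
  unfold lift2 qtlift
  rw [dif_pos h]
  exact h.choose_spec x y

theorem t2_ext {f g : st.T2 → Q} (hf : Lin k f) (hg : Lin k g)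
    (h : ∀ x y, f (st.mk2 x y) = g (st.mk2 x y)) : ∀ z, f z = g z := by
  intro z
  obtain ⟨w, rfl⟩ := Submodule.Quotient.mk_surjective _ z
  revert w
  exact Lin.tensor_ext (k := k) (f := fun w => f (st.rel.mkQ w)) (g := fun w => g (st.rel.mkQ w))
    (by fun_prop) (by fun_prop) h

@[fun_prop]
theorem lin_lift2_arg (f : L → L → Q) {P : Type*} [AddCommGroup P] [Module k P] {g : P → st.T2}
    (hg : Lin k g) : Lin k fun a => st.lift2 f (g a) := .linearMap _ hg

theorem lin_apply_lift2 {f : L → L → Q} {φ : Q → R} (hφ : Lin k φ) (hf : st.Bal f) :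
    ∀ z, φ (st.lift2 f z) = st.lift2 (fun x y => φ (f x y)) z := by
  have hφf : st.Bal fun x y => φ (f x y) :=
    ⟨fun y => hφ.comp (hf.left y), fun x => hφ.comp (hf.right x), fun a x y => by rw [hf.bal]⟩
  refine t2_ext (hφ.comp (by fun_prop)) (by fun_prop) fun x y => ?_
  rw [lift2_mk2 hf, lift2_mk2 hφf]

theorem lin_lift2_fun {P : Type*} [AddCommGroup P] [Module k P] {f : P → L → L → Q} (z : st.T2)
    (h : ∀ x y, Lin k fun a => f a x y) (hf : ∀ a, st.Bal (f a)) :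
    Lin k fun a => st.lift2 (f a) z := by
  constructor
  · intro a b
    revert z
    refine t2_ext (k := k) ?_ ?_ (fun x y => ?_) <;> try fun_prop
    rw [lift2_mk2 (hf _), lift2_mk2 (hf _), lift2_mk2 (hf _), (h x y).map_add]
  · intro c a
    revert z
    refine t2_ext (k := k) ?_ ?_ (fun x y => ?_) <;> try fun_prop
    rw [lift2_mk2 (hf _), lift2_mk2 (hf _), (h x y).map_smul]

theorem lift2_comm {f : L → L → L → L → Q} (h₁ : ∀ c d, st.Bal fun a b => f a b c d)
    (h₂ : ∀ a b, st.Bal fun c d => f a b c d) (z w : st.T2) :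
    st.lift2 (fun a b => st.lift2 (fun c d => f a b c d) w) z =
      st.lift2 (fun c d => st.lift2 (fun a b => f a b c d) z) w := by
  have h₃ : ∀ w : st.T2, st.Bal fun a b => st.lift2 (fun c d => f a b c d) w := fun w =>
    ⟨fun b => lin_lift2_fun w (fun c d => (h₁ c d).left b) fun _ => h₂ _ _,
      fun a => lin_lift2_fun w (fun c d => (h₁ c d).right a) fun _ => h₂ _ _,
      fun r a b => by simp only [(h₁ _ _).bal]⟩
  have h₄ : ∀ z : st.T2, st.Bal fun c d => st.lift2 (fun a b => f a b c d) z := fun z =>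
    ⟨fun d => lin_lift2_fun z (fun a b => (h₂ a b).left d) fun _ => h₁ _ _,
      fun c => lin_lift2_fun z (fun a b => (h₂ a b).right c) fun _ => h₁ _ _,
      fun r c d => by simp only [(h₂ _ _).bal]⟩
  revert z
  refine t2_ext (k := k) (by fun_prop) ?_ fun a b => ?_
  · exact lin_lift2_fun w (fun c d => by fun_prop) h₄
  · rw [lift2_mk2 (h₃ w)]
    simp only [lift2_mk2 (h₁ _ _)]

/-- A left bialgebroid in which `Δ(X s(b)) = X₍₁₎ s(b) ⊗ X₍₂₎` and `Δ(X t(b)) = X₍₁₎ ⊗ X₍₂₎ t(b)`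
are available explicitly. -/
structure IsBgd (st : BgdST k B L) (cop : L →ₗ[k] st.T2) (cou : L →ₗ[k] B) : Prop extends
    st.IsLeftBialgebroid cop cou where
  comul_mul_s : ∀ (b : B) (X : L),
    cop (X * st.s b) = st.lift2 (fun x y => st.mk2 (x * st.s b) y) (cop X)
  comul_mul_t : ∀ (b : B) (X : L),
    cop (X * st.t b) = st.lift2 (fun x y => st.mk2 x (y * st.t b)) (cop X)

variable {cop : L →ₗ[k] st.T2} {cou : L →ₗ[k] B}

section Lift2Comul

variable {f : L → L → Q}

theorem IsBgd.lift2_s_mul (hL : st.IsBgd cop cou) (hf : st.Bal f) (b : B) (X : L) :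
    st.lift2 f (cop (st.s b * X)) = st.lift2 (fun x y => f (st.s b * x) y) (cop X) := by
  rw [hL.comul_s, lin_apply_lift2 (φ := st.lift2 f) (by fun_prop)]
  · simp only [lift2_mk2 hf]
  · refine ⟨by fun_prop, by fun_prop, fun a x y => ?_⟩
    rw [← mul_assoc, st.st_comm, mul_assoc, mk2_t_mul]

theorem IsBgd.lift2_t_mul (hL : st.IsBgd cop cou) (hf : st.Bal f) (b : B) (X : L) :
    st.lift2 f (cop (st.t b * X)) = st.lift2 (fun x y => f x (st.t b * y)) (cop X) := by
  rw [hL.comul_t, lin_apply_lift2 (φ := st.lift2 f) (by fun_prop)]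
  · simp only [lift2_mk2 hf]
  · refine ⟨by fun_prop, by fun_prop, fun a x y => ?_⟩
    rw [mk2_t_mul, ← mul_assoc, st.st_comm, mul_assoc]

theorem bal_mk2_mul_left (r : L) : st.Bal fun x y => st.mk2 (x * r) y :=
  { bal := fun a x y => by rw [mul_assoc, mk2_t_mul] }

theorem bal_mk2_mul_right (r : L) : st.Bal fun x y => st.mk2 x (y * r) :=
  { bal := fun a x y => by rw [mul_assoc, mk2_t_mul] }

theorem IsBgd.lift2_mul_s (hL : st.IsBgd cop cou) (hf : st.Bal f) (b : B) (X : L) :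
    st.lift2 f (cop (X * st.s b)) = st.lift2 (fun x y => f (x * st.s b) y) (cop X) := by
  rw [hL.comul_mul_s, lin_apply_lift2 (φ := st.lift2 f) (by fun_prop) (bal_mk2_mul_left _)]
  simp only [lift2_mk2 hf]

theorem IsBgd.lift2_mul_t (hL : st.IsBgd cop cou) (hf : st.Bal f) (b : B) (X : L) :
    st.lift2 f (cop (X * st.t b)) = st.lift2 (fun x y => f x (y * st.t b)) (cop X) := by
  rw [hL.comul_mul_t, lin_apply_lift2 (φ := st.lift2 f) (by fun_prop) (bal_mk2_mul_right _)]
  simp only [lift2_mk2 hf]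

theorem IsBgd.lift2_takeuchi (hL : st.IsBgd cop cou) (hf : st.Bal f) (b : B) (X : L) :
    st.lift2 (fun x y => f (x * st.t b) y) (cop X) =
      st.lift2 (fun x y => f x (y * st.s b)) (cop X) := by
  have h := congrArg (st.lift2 f) (hL.takeuchi b X)
  rw [lin_apply_lift2 (φ := st.lift2 f) (by fun_prop) (bal_mk2_mul_left _),
    lin_apply_lift2 (φ := st.lift2 f) (by fun_prop) (bal_mk2_mul_right _)] at h
  simpa only [lift2_mk2 hf] using h

end Lift2Comul

/-- The expression `f(X₍₁₎, Y₍₁₎, X₍₂₎, Y₍₂₎)`. -/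
def lift22 (st : BgdST k B L) (cop : L →ₗ[k] st.T2) (f : L → L → L → L → Q) (X Y : L) : Q :=
  st.lift2 (fun y1 y2 => st.lift2 (fun x1 x2 => f x1 y1 x2 y2) (cop X)) (cop Y)

/-- Sufficient conditions for `f(X₍₁₎, Y₍₁₎, X₍₂₎, Y₍₂₎)` to be well defined. -/
structure Bal22 (st : BgdST k B L) (f : L → L → L → L → Q) : Prop where
  lin₁ : ∀ y1 x2 y2, Lin k fun x1 => f x1 y1 x2 y2 := by fun_prop
  lin₂ : ∀ x1 x2 y2, Lin k fun y1 => f x1 y1 x2 y2 := by fun_prop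
  lin₃ : ∀ x1 y1 y2, Lin k fun x2 => f x1 y1 x2 y2 := by fun_prop
  lin₄ : ∀ x1 y1 x2, Lin k fun y2 => f x1 y1 x2 y2 := by fun_prop
  bal : ∀ a x1 y1 x2 y2, f (st.t a * x1) y1 x2 y2 = f x1 y1 (st.s a * x2) y2
  t_mul : ∀ a x1 y1 x2 y2, f x1 (st.t a * y1) x2 y2 = f (x1 * st.t a) y1 x2 y2
  s_mul : ∀ a x1 y1 x2 y2, f x1 y1 x2 (st.s a * y2) = f x1 y1 (x2 * st.s a) y2

section Lift22

variable {f : L → L → L → L → Q}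

theorem Bal22.bal_inner (hf : st.Bal22 f) (y1 y2 : L) : st.Bal fun x1 x2 => f x1 y1 x2 y2 :=
  ⟨fun x2 => hf.lin₁ y1 x2 y2, fun x1 => hf.lin₃ x1 y1 y2, fun a x1 x2 => hf.bal a x1 y1 x2 y2⟩

theorem Bal22.bal_outer (hL : st.IsBgd cop cou) (hf : st.Bal22 f) (X : L) :
    st.Bal fun y1 y2 => st.lift2 (fun x1 x2 => f x1 y1 x2 y2) (cop X) :=
  ⟨fun y2 => lin_lift2_fun _ (fun x1 x2 => hf.lin₂ x1 x2 y2) fun _ => hf.bal_inner _ _,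
    fun y1 => lin_lift2_fun _ (fun x1 x2 => hf.lin₄ x1 y1 x2) fun _ => hf.bal_inner _ _,
    fun a y1 y2 => by
      simp only [hf.t_mul, hf.s_mul]
      exact hL.lift2_takeuchi (hf.bal_inner y1 y2) a X⟩

theorem Bal22.lin_right (f : L → L → L → L → Q) (X : L) :
    Lin k fun Y => lift22 st cop f X Y := by
  unfold lift22
  fun_prop

theorem Bal22.lin_left (hL : st.IsBgd cop cou) (hf : st.Bal22 f) (Y : L) :
    Lin k fun X => lift22 st cop f X Y :=
  lin_lift2_fun _ (by fun_prop) fun X => hf.bal_outer hL X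

theorem Bal22.s_mul_left (hL : st.IsBgd cop cou) (hf : st.Bal22 f) (b : B) (X Y : L) :
    lift22 st cop f (st.s b * X) Y =
      lift22 st cop (fun x1 y1 x2 y2 => f (st.s b * x1) y1 x2 y2) X Y := by
  simp only [lift22, hL.lift2_s_mul (hf.bal_inner _ _)]

theorem Bal22.t_mul_left (hL : st.IsBgd cop cou) (hf : st.Bal22 f) (b : B) (X Y : L) :
    lift22 st cop f (st.t b * X) Y =
      lift22 st cop (fun x1 y1 x2 y2 => f x1 y1 (st.t b * x2) y2) X Y := by
  simp only [lift22, hL.lift2_t_mul (hf.bal_inner _ _)]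

theorem Bal22.mul_s_left (hL : st.IsBgd cop cou) (hf : st.Bal22 f) (b : B) (X Y : L) :
    lift22 st cop f (X * st.s b) Y =
      lift22 st cop (fun x1 y1 x2 y2 => f (x1 * st.s b) y1 x2 y2) X Y := by
  simp only [lift22, hL.lift2_mul_s (hf.bal_inner _ _)]

theorem Bal22.mul_t_left (hL : st.IsBgd cop cou) (hf : st.Bal22 f) (b : B) (X Y : L) :
    lift22 st cop f (X * st.t b) Y =
      lift22 st cop (fun x1 y1 x2 y2 => f x1 y1 (x2 * st.t b) y2) X Y := by
  simp only [lift22, hL.lift2_mul_t (hf.bal_inner _ _)]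

theorem Bal22.s_mul_right (hL : st.IsBgd cop cou) (hf : st.Bal22 f) (b : B) (X Y : L) :
    lift22 st cop f X (st.s b * Y) =
      lift22 st cop (fun x1 y1 x2 y2 => f x1 (st.s b * y1) x2 y2) X Y :=
  hL.lift2_s_mul (hf.bal_outer hL X) b Y

theorem Bal22.t_mul_right (hL : st.IsBgd cop cou) (hf : st.Bal22 f) (b : B) (X Y : L) :
    lift22 st cop f X (st.t b * Y) =
      lift22 st cop (fun x1 y1 x2 y2 => f x1 y1 x2 (st.t b * y2)) X Y :=
  hL.lift2_t_mul (hf.bal_outer hL X) b Y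

theorem Bal22.mul_s_right (hL : st.IsBgd cop cou) (hf : st.Bal22 f) (b : B) (X Y : L) :
    lift22 st cop f X (Y * st.s b) =
      lift22 st cop (fun x1 y1 x2 y2 => f x1 (y1 * st.s b) x2 y2) X Y :=
  hL.lift2_mul_s (hf.bal_outer hL X) b Y

theorem Bal22.apply (hL : st.IsBgd cop cou) (hf : st.Bal22 f) {φ : Q → R} (hφ : Lin k φ)
    (X Y : L) :
    φ (lift22 st cop f X Y) =
      lift22 st cop (fun x1 y1 x2 y2 => φ (f x1 y1 x2 y2)) X Y := by
  unfold lift22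
  rw [lin_apply_lift2 hφ (hf.bal_outer hL X)]
  simp only [lin_apply_lift2 hφ (hf.bal_inner _ _)]

end Lift22

end BgdST

end

noncomputable section

universe u v

/-- The hypotheses identifying a left bialgebroid `L` with `B # H^op` along `ψ`. -/
structure IsActionBgd {k : Type u} [Field k] {H B L : Type v} [Ring H] [HopfAlgebra k H]
    [Ring B] [Algebra k B] [Ring L] [Algebra k L] (act : B →ₗ[k] H →ₗ[k] B)
    (coact : B →ₗ[k] B ⊗[k] H) (ψ : L ≃ₗ[k] B ⊗[k] H) (st : BgdST k B L)
    (cop : L →ₗ[k] st.T2) (cou : L →ₗ[k] B) : Prop where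
  act_one : ∀ b, act b 1 = b
  act_act : ∀ b g h, act (act b g) h = act b (g * h)
  one_act : ∀ h, act 1 h = algebraMap k B (counit (R := k) h)
  mul_act : ∀ a b h, act (a * b) h =
    tlift k (fun h1 h2 => act a h1 * act b h2) (comul (R := k) h)
  act_coact : ∀ a h,
    tlift k (fun h1 h2 => tlift k (fun c0 c1 => c0 ⊗ₜ[k] (h1 * c1)) (coact (act a h2)))
      (comul (R := k) h) =
    tlift k (fun b0 b1 => tlift k (fun h1 h2 => act b0 h1 ⊗ₜ[k] (b1 * h2))
      (comul (R := k) h)) (coact a)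
  map_one : ψ 1 = 1
  map_mul : ∀ x y, ψ (x * y) = smashMul (fun b h => act b h) (ψ x) (ψ y)
  isLeftBialgebroid : st.IsLeftBialgebroid cop cou
  s_eq : ∀ b, st.s b = ψ.symm (b ⊗ₜ[k] (1 : H))
  t_eq : ∀ b, st.t b = ψ.symm (coact b)
  cou_eq : ∀ z, cou z = tlift k (fun a h => counit (R := k) h • a) (ψ z)
  cop_eq : ∀ z, cop z = tlift k (fun a h => tlift k (fun h1 h2 =>
    st.mk2 (ψ.symm (a ⊗ₜ[k] h1)) (ψ.symm ((1 : B) ⊗ₜ[k] h2))) (comul (R := k) h)) (ψ z)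

namespace IsActionBgd

variable {k : Type u} [Field k] {H B L Q : Type v} [Ring H] [HopfAlgebra k H] [Ring B]
  [Algebra k B] [Ring L] [Algebra k L] [AddCommGroup Q] [Module k Q] {act : B →ₗ[k] H →ₗ[k] B}
  {coact : B →ₗ[k] B ⊗[k] H} {ψ : L ≃ₗ[k] B ⊗[k] H} {st : BgdST k B L} {cop : L →ₗ[k] st.T2}
  {cou : L →ₗ[k] B}

/-- The inclusion `h ↦ 1 # h`. -/
def incl (ψ : L ≃ₗ[k] B ⊗[k] H) : H →ₗ[k] L :=
  ψ.symm.toLinearMap ∘ₗ TensorProduct.mk k B H 1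

theorem incl_apply (ψ : L ≃ₗ[k] B ⊗[k] H) (h : H) : incl ψ h = ψ.symm (1 ⊗ₜ h) := rfl

theorem smashMul_tmul (act : B →ₗ[k] H →ₗ[k] B) (a b : B) (h g : H) :
    smashMul (fun b h => act b h) (a ⊗ₜ[k] h) (b ⊗ₜ g) =
      tlift k (fun h1 h2 => (a * act b h1) ⊗ₜ[k] (g * h2)) (comul (R := k) h) := by
  unfold smashMul
  rw [tlift_tmul, tlift_tmul]

theorem incl_one (S : IsActionBgd act coact ψ st cop cou) : incl ψ 1 = 1 := by
  rw [incl_apply, ← Algebra.TensorProduct.one_def, ← S.map_one, ψ.symm_apply_apply]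

theorem s_mul_incl (S : IsActionBgd act coact ψ st cop cou) (a : B) (h : H) :
    st.s a * incl ψ h = ψ.symm (a ⊗ₜ h) := by
  apply ψ.injective
  rw [S.map_mul, S.s_eq, incl_apply]
  simp only [ψ.apply_symm_apply]
  rw [smashMul_tmul, tlift_comul_one, S.act_one, mul_one, mul_one]

theorem incl_mul_incl (S : IsActionBgd act coact ψ st cop cou) (h g : H) :
    incl ψ h * incl ψ g = incl ψ (g * h) := by
  apply ψ.injective
  rw [S.map_mul]
  simp only [incl_apply, ψ.apply_symm_apply]
  rw [smashMul_tmul]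
  simp only [S.one_act, one_mul, Algebra.algebraMap_eq_smul_one, ← TensorProduct.smul_tmul']
  rw [tlift_counit_left (f := fun x => (1 : B) ⊗ₜ[k] (g * x))]

theorem incl_mul_s (S : IsActionBgd act coact ψ st cop cou) (h : H) (b : B) : incl ψ h * st.s b =
    tlift k (fun h1 h2 => st.s (act b h1) * incl ψ h2) (comul (R := k) h) := by
  apply ψ.injective
  rw [S.map_mul, lin_apply_tlift (φ := ψ) (by fun_prop)]
  simp only [incl_apply, S.s_eq b, ψ.apply_symm_apply]
  simp only [← incl_apply, S.s_mul_incl, ψ.apply_symm_apply]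
  rw [smashMul_tmul]
  simp only [one_mul]

theorem t_eq_tlift (S : IsActionBgd act coact ψ st cop cou) (c : B) :
    st.t c = tlift k (fun c0 c1 => st.s c0 * incl ψ c1) (coact c) := by
  rw [S.t_eq]
  generalize coact c = z
  simp only [S.s_mul_incl]
  revert z
  refine Lin.tensor_ext (k := k) ?_ ?_ (fun a b => ?_) <;> try fun_prop
  rw [tlift_tmul]

theorem t_mul_incl (S : IsActionBgd act coact ψ st cop cou) (c : B) (h : H) :
    st.t c * incl ψ h = tlift k (fun c0 c1 => st.s c0 * incl ψ (h * c1)) (coact c) := by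
  rw [S.t_eq_tlift, lin_apply_tlift (φ := fun x => x * incl ψ h) (by fun_prop)]
  simp only [mul_assoc, S.incl_mul_incl]

theorem incl_mul_t (S : IsActionBgd act coact ψ st cop cou) (h : H) (c : B) : incl ψ h * st.t c =
    tlift k (fun h1 h2 => st.t (act c h2) * incl ψ h1) (comul (R := k) h) := by
  have key := congrArg (tlift k (fun a x => st.s a * incl ψ x)) (S.act_coact c h)
  rw [lin_apply_tlift (φ := tlift k (fun a x => st.s a * incl ψ x)) (by fun_prop),
    lin_apply_tlift (φ := tlift k (fun a x => st.s a * incl ψ x)) (by fun_prop)] at key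
  rw [S.t_eq_tlift, lin_apply_tlift (φ := fun x => incl ψ h * x) (by fun_prop)]
  simp only [S.t_mul_incl]
  refine Eq.trans ?_ (key.symm.trans ?_)
  · congr 2
    funext b0 b1
    rw [← mul_assoc, S.incl_mul_s, lin_apply_tlift (φ := fun x => x * incl ψ b1) (by fun_prop),
      lin_apply_tlift (φ := tlift k (fun a x => st.s a * incl ψ x)) (by fun_prop)]
    congr 2
    funext h1 h2
    rw [mul_assoc, S.incl_mul_incl, tlift_tmul]
  · congr 2
    funext h1 h2
    rw [lin_apply_tlift (φ := tlift k (fun a x => st.s a * incl ψ x)) (by fun_prop)]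
    congr 2
    funext c0 c1
    rw [tlift_tmul]

theorem induction (S : IsActionBgd act coact ψ st cop cou) {p : L → Prop}
    (hs : ∀ a h, p (st.s a * incl ψ h))
    (hadd : ∀ x y, p x → p y → p (x + y)) (x : L) : p x := by
  obtain ⟨z, rfl⟩ := ψ.symm.surjective x
  induction z with
  | zero => simpa using hs 0 0
  | tmul a h => rw [← S.s_mul_incl]; exact hs a h
  | add x y hx hy => rw [_root_.map_add]; exact hadd _ _ hx hy

theorem lin_ext (S : IsActionBgd act coact ψ st cop cou) {f g : L → Q} (hf : Lin k f) (hg : Lin k g)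
    (h : ∀ a x, f (st.s a * incl ψ x) = g (st.s a * incl ψ x)) (X : L) : f X = g X :=
  S.induction (p := fun X => f X = g X) h
    (fun x y hx hy => by rw [hf.map_add, hg.map_add, hx, hy]) X

theorem cop_s_mul_incl (S : IsActionBgd act coact ψ st cop cou) (a : B) (h : H) : cop
    (st.s a * incl ψ h) =
    tlift k (fun h1 h2 => st.mk2 (st.s a * incl ψ h1) (incl ψ h2)) (comul (R := k) h) := by
  rw [S.cop_eq, S.s_mul_incl, ψ.apply_symm_apply, tlift_tmul]
  simp only [S.s_mul_incl]
  rfl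

theorem lift2_cop_s_mul_incl (S : IsActionBgd act coact ψ st cop cou) {f : L → L → Q}
    (hf : st.Bal f) (a : B) (h : H) :
    st.lift2 f (cop (st.s a * incl ψ h)) =
      tlift k (fun h1 h2 => f (st.s a * incl ψ h1) (incl ψ h2)) (comul (R := k) h) := by
  rw [S.cop_s_mul_incl, lin_apply_tlift (φ := st.lift2 f) (by fun_prop)]
  simp only [BgdST.lift2_mk2 hf]

theorem lift2_cop_incl (S : IsActionBgd act coact ψ st cop cou) {f : L → L → Q} (hf : st.Bal f)
    (h : H) :
    st.lift2 f (cop (incl ψ h)) =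
      tlift k (fun h1 h2 => f (incl ψ h1) (incl ψ h2)) (comul (R := k) h) := by
  have := S.lift2_cop_s_mul_incl hf 1 h
  simpa only [_root_.map_one, one_mul] using this

theorem cou_s_mul_incl (S : IsActionBgd act coact ψ st cop cou) (a : B) (h : H) :
    cou (st.s a * incl ψ h) = counit (R := k) h • a := by
  rw [S.cou_eq, S.s_mul_incl, ψ.apply_symm_apply, tlift_tmul]

theorem cou_incl (S : IsActionBgd act coact ψ st cop cou) (h : H) : cou (incl ψ h) = algebraMap k B
    (counit (R := k) h) := by
  have := S.cou_s_mul_incl 1 h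
  rwa [_root_.map_one, one_mul, ← Algebra.algebraMap_eq_smul_one] at this

theorem isBgd (S : IsActionBgd act coact ψ st cop cou) : st.IsBgd cop cou where
  __ := S.isLeftBialgebroid
  comul_mul_s b := by
    have hb : st.Bal fun x y => st.mk2 (x * st.s b) y := BgdST.bal_mk2_mul_left _
    refine S.lin_ext (by fun_prop) (by fun_prop) fun a h => ?_
    rw [S.lift2_cop_s_mul_incl hb, mul_assoc, S.incl_mul_s,
      lin_apply_tlift (φ := fun x => st.s a * x) (by fun_prop),
      lin_apply_tlift (φ := cop) (by fun_prop)]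
    simp only [mul_assoc, S.incl_mul_s]
    simp only [← mul_assoc, ← _root_.map_mul, S.cop_s_mul_incl]
    rw [← tlift_coassoc (f := fun x y z => st.mk2 (st.s (a * act b x) * incl ψ y) (incl ψ z))]
    congr 2
    funext h1 h2
    rw [lin_apply_tlift (φ := fun x => st.mk2 (st.s a * x) (incl ψ h2)) (by fun_prop)]
    simp only [_root_.map_mul, mul_assoc]
  comul_mul_t b := by
    have hb : st.Bal fun x y => st.mk2 x (y * st.t b) := BgdST.bal_mk2_mul_right _
    have ht (c : B) : st.Bal fun x y => st.mk2 x (st.t c * y) :=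
      { bal := fun a x y => by rw [BgdST.mk2_t_mul, ← mul_assoc, st.st_comm, mul_assoc] }
    refine S.lin_ext (by fun_prop) (by fun_prop) fun a h => ?_
    rw [S.lift2_cop_s_mul_incl hb, mul_assoc, S.incl_mul_t,
      lin_apply_tlift (φ := fun x => st.s a * x) (by fun_prop),
      lin_apply_tlift (φ := cop) (by fun_prop)]
    simp only [← mul_assoc, st.st_comm, S.incl_mul_t]
    simp only [mul_assoc, S.isLeftBialgebroid.comul_t, S.lift2_cop_s_mul_incl (ht _)]
    rw [tlift_coassoc (f := fun x y z =>
      st.mk2 (st.s a * incl ψ x) (st.t (act b z) * incl ψ y))]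
    congr 2
    funext h1 h2
    rw [lin_apply_tlift (φ := fun x => st.mk2 (st.s a * incl ψ h1) x) (by fun_prop)]

theorem lift22_incl (S : IsActionBgd act coact ψ st cop cou) {f : L → L → L → L → Q}
    (hf : st.Bal22 f) (h g : H) :
    st.lift22 cop f (incl ψ h) (incl ψ g) =
      tlift k (fun g1 g2 => tlift k (fun h1 h2 =>
        f (incl ψ h1) (incl ψ g1) (incl ψ h2) (incl ψ g2)) (comul (R := k) h))
        (comul (R := k) g) := by
  unfold BgdST.lift22
  rw [S.lift2_cop_incl (hf.bal_outer S.isBgd _)]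
  simp only [S.lift2_cop_incl (hf.bal_inner _ _)]

end IsActionBgd

namespace IsActionBgd

variable {k : Type u} [Field k] {H B L : Type v} [Ring H] [HopfAlgebra k H] [Ring B]
  [Algebra k B] [Ring L] [Algebra k L] {act : B →ₗ[k] H →ₗ[k] B}
  {coact : B →ₗ[k] B ⊗[k] H} {ψ : L ≃ₗ[k] B ⊗[k] H} {st : BgdST k B L} {cop : L →ₗ[k] st.T2}
  {cou : L →ₗ[k] B}

/-- Bilinear maps `L ⊗ L → B` compatible with the source map; on `B # H^op` these are
determined by their values on `H ⊗ H`. -/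
structure SLin (st : BgdST k B L) (F : L → L → B) : Prop where
  lin_left : ∀ Y, Lin k fun X => F X Y := by fun_prop
  lin_right : ∀ X, Lin k fun Y => F X Y := by fun_prop
  s_mul : ∀ a X Y, F (st.s a * X) Y = a * F X Y
  mul_s : ∀ b X Y, F (X * st.s b) Y = F X (st.s b * Y)

theorem SLin.ext (S : IsActionBgd act coact ψ st cop cou) {F G : L → L → B} (hF : SLin st F)
    (hG : SLin st G) (h : ∀ x y, F (incl ψ x) (incl ψ y) = G (incl ψ x) (incl ψ y)) (X Y : L) :
    F X Y = G X Y := by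
  refine S.lin_ext (hF.lin_right X) (hG.lin_right X) (fun b g => ?_) Y
  rw [← hF.mul_s, ← hG.mul_s]
  refine S.lin_ext (hF.lin_left _) (hG.lin_left _) (fun a x => ?_) (X * st.s b)
  rw [hF.s_mul, hG.s_mul, h]

theorem SLin.mul_const {F : L → L → B} (hF : SLin st F) (c : B) :
    SLin st fun X Y => F X Y * c where
  lin_left Y := (hF.lin_left Y).mul_const c
  lin_right X := (hF.lin_right X).mul_const c
  s_mul a X Y := by rw [hF.s_mul, mul_assoc]
  mul_s b X Y := by rw [hF.mul_s]

section Conditions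

variable {Γ : L →ₗ[k] L →ₗ[k] B}

theorem apply_incl_s_mul_incl (S : IsActionBgd act coact ψ st cop cou)
    (E : SLin st fun X Y => Γ X Y) (h g : H) (b : B) :
    Γ (incl ψ h) (st.s b * incl ψ g) =
      tlift k (fun h1 h2 => act b h1 * Γ (incl ψ h2) (incl ψ g)) (comul (R := k) h) := by
  rw [← E.mul_s, S.incl_mul_s, lin_apply_tlift (φ := fun x => Γ x (incl ψ g)) (by fun_prop)]
  simp only [E.s_mul]

theorem apply_t_mul_incl (S : IsActionBgd act coact ψ st cop cou)
    (E : SLin st fun X Y => Γ X Y) (h g : H) (c : B) :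
    Γ (st.t c * incl ψ h) (incl ψ g) =
      tlift k (fun c0 c1 => c0 * Γ (incl ψ (h * c1)) (incl ψ g)) (coact c) := by
  rw [S.t_mul_incl, lin_apply_tlift (φ := fun x => Γ x (incl ψ g)) (by fun_prop)]
  simp only [E.s_mul]

theorem apply_incl_t_mul_incl (S : IsActionBgd act coact ψ st cop cou)
    (E : SLin st fun X Y => Γ X Y) (h g : H) (c : B) :
    Γ (incl ψ h) (st.t c * incl ψ g) =
      tlift k (fun c0 c1 => tlift k (fun h1 h2 => act c0 h1 *
        Γ (incl ψ h2) (incl ψ (g * c1))) (comul (R := k) h)) (coact c) := by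
  rw [S.t_mul_incl, lin_apply_tlift (φ := Γ (incl ψ h)) (by fun_prop)]
  simp only [S.apply_incl_s_mul_incl E]

theorem apply_incl_mul_t_incl (S : IsActionBgd act coact ψ st cop cou)
    (T : ∀ c X Y, Γ (st.t c * X) Y = Γ X Y * c) (h g : H) (c : B) :
    Γ (incl ψ h * st.t c) (incl ψ g) =
      tlift k (fun h1 h2 => Γ (incl ψ h1) (incl ψ g) * act c h2) (comul (R := k) h) := by
  rw [S.incl_mul_t, lin_apply_tlift (φ := fun x => Γ x (incl ψ g)) (by fun_prop)]
  simp only [T]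

theorem apply_incl_incl_mul_s (S : IsActionBgd act coact ψ st cop cou)
    (E : SLin st fun X Y => Γ X Y) (h g : H) (b : B) :
    Γ (incl ψ h) (incl ψ g * st.s b) =
      tlift k (fun h1 h2 => tlift k (fun g1 g2 => act b (g1 * h1) *
        Γ (incl ψ h2) (incl ψ g2)) (comul (R := k) g)) (comul (R := k) h) := by
  rw [S.incl_mul_s, lin_apply_tlift (φ := Γ (incl ψ h)) (by fun_prop), tlift_comm]
  simp only [S.apply_incl_s_mul_incl E, S.act_act]

theorem apply_incl_incl_mul_t (S : IsActionBgd act coact ψ st cop cou)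
    (T : ∀ c X Y, Γ (st.t c * X) Y = Γ X Y * c)
    (M : ∀ c X Y, Γ (X * st.t c) Y = Γ X (st.t c * Y)) (h g : H) (b : B) :
    Γ (incl ψ h) (incl ψ g * st.t b) =
      tlift k (fun h1 h2 => tlift k (fun g1 g2 => Γ (incl ψ h1) (incl ψ g1) *
        act b (g2 * h2)) (comul (R := k) g)) (comul (R := k) h) := by
  rw [S.incl_mul_t, lin_apply_tlift (φ := Γ (incl ψ h)) (by fun_prop), tlift_comm]
  simp only [← M, S.apply_incl_mul_t_incl T, S.act_act]

theorem t_mul_iff (S : IsActionBgd act coact ψ st cop cou) (E : SLin st fun X Y => Γ X Y) :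
    (∀ c X Y, Γ (st.t c * X) Y = Γ X Y * c) ↔ ∀ (h g : H) (c : B),
      tlift k (fun c0 c1 => c0 * Γ (incl ψ (h * c1)) (incl ψ g)) (coact c) =
        Γ (incl ψ h) (incl ψ g) * c := by
  simp only [← S.apply_t_mul_incl E]
  refine ⟨fun h x y c => h c _ _, fun h c X Y => ?_⟩
  refine SLin.ext S (F := fun X Y => Γ (st.t c * X) Y) (G := fun X Y => Γ X Y * c)
    { s_mul := fun a X Y => ?_, mul_s := fun b X Y => ?_ } (E.mul_const c) (h · · c) X Y
  · rw [← mul_assoc, ← st.st_comm, mul_assoc, E.s_mul]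
  · rw [← mul_assoc, E.mul_s]

theorem mul_t_iff (S : IsActionBgd act coact ψ st cop cou) (E : SLin st fun X Y => Γ X Y)
    (T : ∀ c X Y, Γ (st.t c * X) Y = Γ X Y * c) :
    (∀ c X Y, Γ (X * st.t c) Y = Γ X (st.t c * Y)) ↔ ∀ (h g : H) (c : B),
      tlift k (fun h1 h2 => Γ (incl ψ h1) (incl ψ g) * act c h2) (comul (R := k) h) =
      tlift k (fun c0 c1 => tlift k (fun h1 h2 => act c0 h1 *
        Γ (incl ψ h2) (incl ψ (g * c1))) (comul (R := k) h)) (coact c) := by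
  simp only [← S.apply_incl_mul_t_incl T, ← S.apply_incl_t_mul_incl E]
  refine ⟨fun h x y c => h c _ _, fun h c X Y => ?_⟩
  refine SLin.ext S (F := fun X Y => Γ (X * st.t c) Y) (G := fun X Y => Γ X (st.t c * Y))
    { s_mul := fun a X Y => ?_, mul_s := fun b X Y => ?_ }
    { s_mul := fun a X Y => ?_, mul_s := fun b X Y => ?_ } (h · · c) X Y
  · rw [mul_assoc, E.s_mul]
  · rw [mul_assoc, st.st_comm, ← mul_assoc, E.mul_s]
  · rw [E.s_mul]
  · rw [E.mul_s, ← mul_assoc, st.st_comm, mul_assoc]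

theorem st_indep_iff (S : IsActionBgd act coact ψ st cop cou) (E : SLin st fun X Y => Γ X Y)
    (T : ∀ c X Y, Γ (st.t c * X) Y = Γ X Y * c)
    (M : ∀ c X Y, Γ (X * st.t c) Y = Γ X (st.t c * Y)) :
    (∀ b X Y, Γ X (Y * st.s b) = Γ X (Y * st.t b)) ↔ ∀ (h g : H) (b : B),
      tlift k (fun h1 h2 => tlift k (fun g1 g2 => Γ (incl ψ h1) (incl ψ g1) *
        act b (g2 * h2)) (comul (R := k) g)) (comul (R := k) h) =
      tlift k (fun h1 h2 => tlift k (fun g1 g2 => act b (g1 * h1) *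
        Γ (incl ψ h2) (incl ψ g2)) (comul (R := k) g)) (comul (R := k) h) := by
  simp only [← S.apply_incl_incl_mul_s E, ← S.apply_incl_incl_mul_t T M]
  refine ⟨fun h x y c => (h c _ _).symm, fun h c X Y => ?_⟩
  refine SLin.ext S (F := fun X Y => Γ X (Y * st.s c)) (G := fun X Y => Γ X (Y * st.t c))
    { s_mul := fun a X Y => ?_, mul_s := fun b X Y => ?_ }
    { s_mul := fun a X Y => ?_, mul_s := fun b X Y => ?_ } (fun x y => (h x y c).symm) X Y
  · rw [E.s_mul]
  · rw [E.mul_s, mul_assoc]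
  · rw [E.s_mul]
  · rw [E.mul_s, mul_assoc]

theorem norm_left_iff (S : IsActionBgd act coact ψ st cop cou) (E : SLin st fun X Y => Γ X Y) :
    (∀ X, Γ 1 X = cou X) ↔
      ∀ h : H, Γ (incl ψ 1) (incl ψ h) = algebraMap k B (counit (R := k) h) := by
  rw [S.incl_one]
  refine ⟨fun h x => by rw [h, S.cou_incl], fun h => S.lin_ext (by fun_prop) (by fun_prop) ?_⟩
  intro a x
  rw [← E.mul_s, one_mul, ← mul_one (st.s a), E.s_mul, h, mul_one, S.cou_s_mul_incl,
    Algebra.smul_def', ← Algebra.commutes]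

theorem norm_right_iff (S : IsActionBgd act coact ψ st cop cou) (E : SLin st fun X Y => Γ X Y) :
    (∀ X, Γ X 1 = cou X) ↔
      ∀ h : H, Γ (incl ψ h) (incl ψ 1) = algebraMap k B (counit (R := k) h) := by
  rw [S.incl_one]
  refine ⟨fun h x => by rw [h, S.cou_incl], fun h => S.lin_ext (by fun_prop) (by fun_prop) ?_⟩
  intro a x
  rw [E.s_mul, h, S.cou_s_mul_incl, Algebra.smul_def', ← Algebra.commutes]

end Conditions

end IsActionBgd

namespace BgdST

theorem lin_lift22_fun {k : Type*} [Field k] {B L P Q : Type*} [Ring B] [Algebra k B] [Ring L]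
    [Algebra k L] [AddCommGroup P] [Module k P] [AddCommGroup Q] [Module k Q] {st : BgdST k B L}
    {cop : L →ₗ[k] st.T2} {cou : L →ₗ[k] B} (hL : st.IsBgd cop cou) {f : P → L → L → L → L → Q}
    (hf : ∀ a, st.Bal22 (f a)) (h : ∀ x1 y1 x2 y2, Lin k fun a => f a x1 y1 x2 y2) (X Y : L) :
    Lin k fun a => st.lift22 cop (f a) X Y :=
  lin_lift2_fun _ (fun _ _ => lin_lift2_fun _ (fun _ _ => h _ _ _ _) fun a => (hf a).bal_inner _ _)
    fun a => (hf a).bal_outer hL X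

end BgdST

namespace IsActionBgd

variable {k : Type u} [Field k] {H B L : Type v} [Ring H] [HopfAlgebra k H] [Ring B]
  [Algebra k B] [Ring L] [Algebra k L] {act : B →ₗ[k] H →ₗ[k] B}
  {coact : B →ₗ[k] B ⊗[k] H} {ψ : L ≃ₗ[k] B ⊗[k] H} {st : BgdST k B L} {cop : L →ₗ[k] st.T2}
  {cou : L →ₗ[k] B} {Γ : L →ₗ[k] L →ₗ[k] B}

theorem bal22_cocL (T : ∀ c X Y, Γ (st.t c * X) Y = Γ X Y * c)
    (M : ∀ c X Y, Γ (X * st.t c) Y = Γ X (st.t c * Y)) (X : L) :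
    st.Bal22 fun y1 z1 y2 z2 => Γ X (st.s (Γ y1 z1) * (y2 * z2)) where
  bal a y1 z1 y2 z2 := by simp only [T, _root_.map_mul, mul_assoc]
  t_mul a y1 z1 y2 z2 := by rw [M]
  s_mul a y1 z1 y2 z2 := by rw [← mul_assoc y2]

theorem bal22_cocR (T : ∀ c X Y, Γ (st.t c * X) Y = Γ X Y * c)
    (M : ∀ c X Y, Γ (X * st.t c) Y = Γ X (st.t c * Y)) (Z : L) :
    st.Bal22 fun x1 y1 x2 y2 => Γ (st.s (Γ x1 y1) * (x2 * y2)) Z where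
  bal a y1 z1 y2 z2 := by simp only [T, _root_.map_mul, mul_assoc]
  t_mul a y1 z1 y2 z2 := by rw [M]
  s_mul a y1 z1 y2 z2 := by rw [← mul_assoc y2]

theorem cocL_incl (S : IsActionBgd act coact ψ st cop cou) (E : SLin st fun X Y => Γ X Y)
    (T : ∀ c X Y, Γ (st.t c * X) Y = Γ X Y * c)
    (M : ∀ c X Y, Γ (X * st.t c) Y = Γ X (st.t c * Y)) (h g f : H) :
    st.cocL cop (fun X Y => Γ X Y) (incl ψ h) (incl ψ g) (incl ψ f) =
    tlift k (fun h1 h2 => tlift k (fun g1 g2 => tlift k (fun f1 f2 =>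
      act (Γ (incl ψ g1) (incl ψ f1)) h1 * Γ (incl ψ h2) (incl ψ (f2 * g2)))
        (comul (R := k) f)) (comul (R := k) g)) (comul (R := k) h) := by
  refine (S.lift22_incl (bal22_cocL T M _) g f).trans ?_
  simp only [S.incl_mul_incl, S.apply_incl_s_mul_incl E]
  rw [tlift_comm (comul (R := k) h)]
  rw [tlift_comm (comul (R := k) f)]
  congr 2
  funext g1 g2
  rw [tlift_comm]

theorem cocR_incl (S : IsActionBgd act coact ψ st cop cou) (E : SLin st fun X Y => Γ X Y)
    (T : ∀ c X Y, Γ (st.t c * X) Y = Γ X Y * c)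
    (M : ∀ c X Y, Γ (X * st.t c) Y = Γ X (st.t c * Y)) (h g f : H) :
    st.cocR cop (fun X Y => Γ X Y) (incl ψ h) (incl ψ g) (incl ψ f) =
    tlift k (fun h1 h2 => tlift k (fun g1 g2 =>
      Γ (incl ψ h1) (incl ψ g1) * Γ (incl ψ (g2 * h2)) (incl ψ f)) (comul (R := k) g))
        (comul (R := k) h) := by
  refine (S.lift22_incl (bal22_cocR T M _) h g).trans ?_
  simp only [S.incl_mul_incl, E.s_mul]
  rw [tlift_comm]

theorem cocycle_iff (S : IsActionBgd act coact ψ st cop cou) (E : SLin st fun X Y => Γ X Y)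
    (T : ∀ c X Y, Γ (st.t c * X) Y = Γ X Y * c)
    (M : ∀ c X Y, Γ (X * st.t c) Y = Γ X (st.t c * Y))
    (I : ∀ b X Y, Γ X (Y * st.s b) = Γ X (Y * st.t b)) :
    (∀ X Y Z, st.cocL cop (fun X Y => Γ X Y) X Y Z = st.cocR cop (fun X Y => Γ X Y) X Y Z) ↔
    ∀ h g f : H, tlift k (fun h1 h2 => tlift k (fun g1 g2 => tlift k (fun f1 f2 =>
      act (Γ (incl ψ g1) (incl ψ f1)) h1 * Γ (incl ψ h2) (incl ψ (f2 * g2)))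
        (comul (R := k) f)) (comul (R := k) g)) (comul (R := k) h) =
    tlift k (fun h1 h2 => tlift k (fun g1 g2 =>
      Γ (incl ψ h1) (incl ψ g1) * Γ (incl ψ (g2 * h2)) (incl ψ f)) (comul (R := k) g))
        (comul (R := k) h) := by
  simp only [← S.cocL_incl E T M, ← S.cocR_incl E T M]
  refine ⟨fun h x y z => h _ _ _, fun key X Y Z => ?_⟩
  have hL := S.isBgd
  have balL := bal22_cocL T M
  have balR := bal22_cocR T M
  change ∀ h g f, st.lift22 cop (fun y1 z1 y2 z2 => Γ (incl ψ h) (st.s (Γ y1 z1) * (y2 * z2)))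
      (incl ψ g) (incl ψ f) = st.lift22 cop (fun x1 y1 x2 y2 => Γ (st.s (Γ x1 y1) * (x2 * y2))
      (incl ψ f)) (incl ψ h) (incl ψ g) at key
  change st.lift22 cop (fun y1 z1 y2 z2 => Γ X (st.s (Γ y1 z1) * (y2 * z2))) Y Z =
    st.lift22 cop (fun x1 y1 x2 y2 => Γ (st.s (Γ x1 y1) * (x2 * y2)) Z) X Y
  refine S.lin_ext (BgdST.Bal22.lin_right _ _)
    (BgdST.lin_lift22_fun hL balR (by fun_prop) _ _) (fun c f => ?_) Z
  have h₁ : st.lift22 cop (fun y1 z1 y2 z2 => Γ X (st.s (Γ y1 z1) * (y2 * z2))) Y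
      (st.s c * incl ψ f) = st.lift22 cop (fun y1 z1 y2 z2 => Γ X (st.s (Γ y1 z1) * (y2 * z2)))
      (Y * st.s c) (incl ψ f) := by
    rw [(balL X).s_mul_right hL, (balL X).mul_s_left hL]
    simp only [E.mul_s]
  have h₂ : st.lift22 cop (fun x1 y1 x2 y2 => Γ (st.s (Γ x1 y1) * (x2 * y2))
      (st.s c * incl ψ f)) X Y = st.lift22 cop (fun x1 y1 x2 y2 => Γ (st.s (Γ x1 y1) * (x2 * y2))
      (incl ψ f)) X (Y * st.s c) := by
    rw [(balR _).mul_s_right hL]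
    simp only [I]
    refine Eq.trans ?_ (hL.lift2_takeuchi ((balR (incl ψ f)).bal_outer hL X) c Y).symm
    simp only [← E.mul_s, mul_assoc]
    rfl
  rw [h₁, h₂]
  refine S.lin_ext ((balL X).lin_left hL _) (BgdST.Bal22.lin_right _ _) (fun b g => ?_) (Y * st.s c)
  have h₃ : st.lift22 cop (fun y1 z1 y2 z2 => Γ X (st.s (Γ y1 z1) * (y2 * z2)))
      (st.s b * incl ψ g) (incl ψ f) = st.lift22 cop (fun y1 z1 y2 z2 =>
      Γ (X * st.s b) (st.s (Γ y1 z1) * (y2 * z2))) (incl ψ g) (incl ψ f) := by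
    rw [(balL X).s_mul_left hL]
    simp only [E.s_mul, E.mul_s, _root_.map_mul, mul_assoc]
  have h₄ : st.lift22 cop (fun x1 y1 x2 y2 => Γ (st.s (Γ x1 y1) * (x2 * y2)) (incl ψ f)) X
      (st.s b * incl ψ g) = st.lift22 cop (fun x1 y1 x2 y2 => Γ (st.s (Γ x1 y1) * (x2 * y2))
      (incl ψ f)) (X * st.s b) (incl ψ g) := by
    rw [(balR _).s_mul_right hL, (balR _).mul_s_left hL]
    simp only [E.mul_s]
  rw [h₃, h₄]
  refine S.lin_ext (BgdST.lin_lift22_fun hL balL (by fun_prop) _ _) ((balR _).lin_left hL _)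
    (fun a h => ?_) (X * st.s b)
  rw [(balR _).s_mul_left hL]
  simp only [E.s_mul, _root_.map_mul, mul_assoc]
  rw [← (balL _).apply hL (φ := fun x => a * x) (by fun_prop), key,
    (balR _).apply hL (φ := fun x => a * x) (by fun_prop)]
  simp only [E.s_mul]

end IsActionBgd

section ConvBB

variable {k : Type u} [Field k] {H B : Type v} [Ring H] [HopfAlgebra k H] [Ring B] [Algebra k B]

theorem convBB_assoc (α β δ : H →ₗ[k] H →ₗ[k] B) (h g : H) :
    convBB (k := k) (fun h g => α h g)
        (fun h g => convBB (k := k) (fun h g => β h g) (fun h g => δ h g) h g) h g =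
      convBB (k := k) (fun h g => convBB (k := k) (fun h g => α h g) (fun h g => β h g) h g)
        (fun h g => δ h g) h g := by
  unfold convBB
  calc
    _ = tlift k (fun h1 h' => tlift k (fun h2 h3 => tlift k (fun g1 g' => tlift k (fun g2 g3 =>
          α h1 g1 * (β h2 g2 * δ h3 g3)) (comul (R := k) g')) (comul (R := k) g))
          (comul (R := k) h')) (comul (R := k) h) := by
      congr 2
      funext h1 h'
      rw [tlift_comm]
      congr 2
      funext g1 g'
      rw [lin_apply_tlift (φ := fun x => α h1 g1 * x) (by fun_prop)]
      congr 2
      funext h2 h3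
      rw [lin_apply_tlift (φ := fun x => α h1 g1 * x) (by fun_prop)]
    _ = tlift k (fun h' h3 => tlift k (fun h1 h2 => tlift k (fun g' g3 => tlift k (fun g1 g2 =>
          α h1 g1 * β h2 g2 * δ h3 g3) (comul (R := k) g')) (comul (R := k) g))
          (comul (R := k) h')) (comul (R := k) h) := by
      rw [← tlift_coassoc (f := fun h1 h2 h3 => tlift k (fun g1 g' => tlift k (fun g2 g3 =>
          α h1 g1 * (β h2 g2 * δ h3 g3)) (comul (R := k) g')) (comul (R := k) g))]
      congr 2
      funext h' h3
      congr 2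
      funext h1 h2
      rw [← tlift_coassoc (f := fun g1 g2 g3 => α h1 g1 * (β h2 g2 * δ h3 g3))]
      simp only [mul_assoc]
    _ = _ := by
      congr 2
      funext h' h3
      rw [tlift_comm]
      congr 2
      funext g' g3
      rw [lin_apply_tlift (φ := fun x => x * δ h3 g3) (by fun_prop)]
      congr 2
      funext h1 h2
      rw [lin_apply_tlift (φ := fun x => x * δ h3 g3) (by fun_prop)]

theorem convBB_counit_left (α : H →ₗ[k] H →ₗ[k] B) (h g : H) :
    convBB (k := k) (fun h g => algebraMap k B (counit (R := k) h * counit (R := k) g))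
      (fun h g => α h g) h g = α h g := by
  unfold convBB
  simp only [← Algebra.smul_def, mul_smul]
  rw [← tlift_counit_left (k := k) (f := fun h => α h g) h]
  congr 2
  funext h1 h2
  rw [← tlift_counit_left (k := k) (f := fun g => α h2 g) g,
    lin_apply_tlift (k := k) (φ := fun x => counit (R := k) h1 • x) (by fun_prop)]

theorem convBB_left_cancel {α αi β δ : H →ₗ[k] H →ₗ[k] B}
    (hα : ∀ h g, convBB (k := k) (fun h g => αi h g) (fun h g => α h g) h g =
      algebraMap k B (counit (R := k) h * counit (R := k) g))
    (h : ∀ h g, convBB (k := k) (fun h g => α h g) (fun h g => β h g) h g =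
      convBB (k := k) (fun h g => α h g) (fun h g => δ h g) h g) (x y : H) :
    β x y = δ x y := by
  rw [← convBB_counit_left β, ← convBB_counit_left δ]
  simp only [← hα, ← convBB_assoc, h]

end ConvBB

namespace IsActionBgd

variable {k : Type u} [Field k] {H B L : Type v} [Ring H] [HopfAlgebra k H] [Ring B]
  [Algebra k B] [Ring L] [Algebra k L] {act : B →ₗ[k] H →ₗ[k] B}
  {coact : B →ₗ[k] B ⊗[k] H} {ψ : L ≃ₗ[k] B ⊗[k] H} {st : BgdST k B L} {cop : L →ₗ[k] st.T2}
  {cou : L →ₗ[k] B} {Γ : L →ₗ[k] L →ₗ[k] B}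

/-- The bilinear extension `Γ_γ` of `γ` to `B # H^op`. -/
def ext (act : B →ₗ[k] H →ₗ[k] B) (ψ : L ≃ₗ[k] B ⊗[k] H) (γ : H →ₗ[k] H →ₗ[k] B) :
    L →ₗ[k] L →ₗ[k] B :=
  bilinOfLin (f := gammaSmash (fun b h => act b h) ψ fun h g => γ h g)
    (by unfold gammaSmash; fun_prop) (by unfold gammaSmash; fun_prop)

theorem ext_apply (act : B →ₗ[k] H →ₗ[k] B) (ψ : L ≃ₗ[k] B ⊗[k] H) (γ : H →ₗ[k] H →ₗ[k] B)
    (X Y : L) : ext act ψ γ X Y = gammaSmash (fun b h => act b h) ψ (fun h g => γ h g) X Y :=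
  rfl

theorem ext_s_mul_incl (S : IsActionBgd act coact ψ st cop cou) (γ : H →ₗ[k] H →ₗ[k] B)
    (a b : B) (h g : H) : ext act ψ γ (st.s a * incl ψ h) (st.s b * incl ψ g) =
      tlift k (fun h1 h2 => a * act b h1 * γ h2 g) (comul (R := k) h) := by
  rw [ext_apply, gammaSmash, S.s_mul_incl, S.s_mul_incl, ψ.apply_symm_apply, ψ.apply_symm_apply,
    tlift_tmul, tlift_tmul]

theorem ext_incl (S : IsActionBgd act coact ψ st cop cou) (γ : H →ₗ[k] H →ₗ[k] B) (h g : H) :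
    ext act ψ γ (incl ψ h) (incl ψ g) = γ h g := by
  have := S.ext_s_mul_incl γ 1 1 h g
  simp only [_root_.map_one, one_mul, S.one_act, ← Algebra.smul_def] at this
  rw [this, tlift_counit_left (f := fun x => γ x g)]

theorem slin_ext (S : IsActionBgd act coact ψ st cop cou) (γ : H →ₗ[k] H →ₗ[k] B) :
    SLin st fun X Y => ext act ψ γ X Y where
  s_mul a X Y := by
    refine S.lin_ext (f := fun X => ext act ψ γ (st.s a * X) Y)
      (g := fun X => a * ext act ψ γ X Y) (by fun_prop) (by fun_prop)
      (fun b h => ?_) X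
    refine S.lin_ext (f := fun Y => ext act ψ γ (st.s a * (st.s b * incl ψ h)) Y)
      (g := fun Y => a * ext act ψ γ (st.s b * incl ψ h) Y) (by fun_prop) (by fun_prop)
      (fun c g => ?_) Y
    rw [← mul_assoc, ← _root_.map_mul, S.ext_s_mul_incl, S.ext_s_mul_incl,
      lin_apply_tlift (φ := fun x => a * x) (by fun_prop)]
    simp only [mul_assoc]
  mul_s b X Y := by
    refine S.lin_ext (f := fun X => ext act ψ γ (X * st.s b) Y)
      (g := fun X => ext act ψ γ X (st.s b * Y)) (by fun_prop) (by fun_prop) (fun a h => ?_) X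
    refine S.lin_ext (f := fun Y => ext act ψ γ (st.s a * incl ψ h * st.s b) Y)
      (g := fun Y => ext act ψ γ (st.s a * incl ψ h) (st.s b * Y)) (by fun_prop) (by fun_prop)
      (fun c g => ?_) Y
    rw [← mul_assoc, ← _root_.map_mul, S.ext_s_mul_incl, mul_assoc, S.incl_mul_s,
      lin_apply_tlift (φ := fun x => ext act ψ γ (st.s a * x) (st.s c * incl ψ g)) (by fun_prop)]
    simp only [← mul_assoc, ← _root_.map_mul, S.ext_s_mul_incl, S.mul_act]
    rw [← tlift_coassoc (f := fun x y z => a * act b x * act c y * γ z g)]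
    congr 2
    funext h1 h2
    rw [lin_apply_tlift (φ := fun x => a * x * γ h2 g) (by fun_prop)]
    simp only [mul_assoc]

theorem eq_ext (S : IsActionBgd act coact ψ st cop cou) (E : SLin st fun X Y => Γ X Y)
    {γ : H →ₗ[k] H →ₗ[k] B} (h : ∀ x y, Γ (incl ψ x) (incl ψ y) = γ x y) (X Y : L) :
    Γ X Y = ext act ψ γ X Y :=
  SLin.ext S E (S.slin_ext γ) (fun x y => by rw [h, S.ext_incl]) X Y

theorem isBihom_iff : st.IsBihom (fun X Y => Γ X Y) ↔ (SLin st fun X Y => Γ X Y) ∧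
    (∀ c X Y, Γ (st.t c * X) Y = Γ X Y * c) ∧
    ∀ c X Y, Γ (X * st.t c) Y = Γ X (st.t c * Y) := by
  constructor
  · rintro ⟨-, h₁, h₂⟩
    refine ⟨{ s_mul := fun a X Y => ?_, mul_s := fun b X Y => ?_ }, fun c X Y => ?_,
      fun c X Y => ?_⟩
    · simpa only [st.t_one, one_mul, mul_one] using h₁ a 1 X Y
    · simpa only [st.t_one, one_mul, mul_one] using h₂ b 1 X Y
    · simpa only [_root_.map_one, one_mul] using h₁ 1 c X Y
    · simpa only [_root_.map_one, one_mul, mul_one] using h₂ 1 c X Y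
  · rintro ⟨E, T, M⟩
    refine ⟨⟨Γ, fun _ _ => rfl⟩, fun b c X Y => ?_, fun b c X Y => ?_⟩
    · simp only [E.s_mul, T, mul_assoc]
    · simp only [M, E.mul_s]

theorem bal22_conv (T : ∀ c X Y, Γ (st.t c * X) Y = Γ X Y * c)
    (M : ∀ c X Y, Γ (X * st.t c) Y = Γ X (st.t c * Y)) {F : L → L → B} (hF : SLin st F) :
    st.Bal22 fun x1 y1 x2 y2 => Γ x1 y1 * F x2 y2 where
  lin₃ x1 y1 y2 := (hF.lin_left y2).const_mul _
  lin₄ x1 y1 x2 := (hF.lin_right x2).const_mul _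
  bal a x1 y1 x2 y2 := by rw [T, hF.s_mul, mul_assoc]
  t_mul a x1 y1 x2 y2 := by rw [M]
  s_mul a x1 y1 x2 y2 := by rw [hF.mul_s]

theorem slin_conv2 (S : IsActionBgd act coact ψ st cop cou) (E : SLin st fun X Y => Γ X Y)
    (T : ∀ c X Y, Γ (st.t c * X) Y = Γ X Y * c)
    (M : ∀ c X Y, Γ (X * st.t c) Y = Γ X (st.t c * Y)) {F : L → L → B} (hF : SLin st F) :
    SLin st (st.conv2 cop (fun X Y => Γ X Y) F) where
  lin_left Y := (bal22_conv T M hF).lin_left S.isBgd Y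
  lin_right X := BgdST.Bal22.lin_right _ X
  s_mul a X Y := by
    refine ((bal22_conv T M hF).s_mul_left S.isBgd a X Y).trans ?_
    simp only [E.s_mul, mul_assoc]
    exact ((bal22_conv T M hF).apply S.isBgd (φ := fun x => a * x) (by fun_prop) X Y).symm
  mul_s b X Y := by
    refine ((bal22_conv T M hF).mul_s_left S.isBgd b X Y).trans ?_
    simp only [E.mul_s]
    exact ((bal22_conv T M hF).s_mul_right S.isBgd b X Y).symm

theorem conv2_incl (S : IsActionBgd act coact ψ st cop cou)
    (T : ∀ c X Y, Γ (st.t c * X) Y = Γ X Y * c)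
    (M : ∀ c X Y, Γ (X * st.t c) Y = Γ X (st.t c * Y)) {F : L → L → B} (hF : SLin st F)
    (h g : H) : st.conv2 cop (fun X Y => Γ X Y) F (incl ψ h) (incl ψ g) =
      convBB (k := k) (fun h g => Γ (incl ψ h) (incl ψ g)) (fun h g => F (incl ψ h) (incl ψ g))
        h g := by
  refine (S.lift22_incl (bal22_conv T M hF) h g).trans ?_
  unfold convBB
  have h₁ := hF.lin_left
  have h₂ := hF.lin_right
  rw [tlift_comm _ _ (by fun_prop) (fun a c d => ?_) (by fun_prop) fun a b c => ?_]
  · exact ((h₂ _).comp (g := incl ψ) (by fun_prop)).const_mul _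
  · exact ((h₁ _).comp (g := incl ψ) (by fun_prop)).const_mul _

theorem slin_unit2 (S : IsActionBgd act coact ψ st cop cou) :
    SLin st (BgdST.unit2 cou) where
  lin_left _ := by unfold BgdST.unit2; fun_prop
  lin_right _ := by unfold BgdST.unit2; fun_prop
  s_mul a X Y := by simp only [BgdST.unit2, mul_assoc, S.isLeftBialgebroid.counit_s]
  mul_s b X Y := by simp only [BgdST.unit2, mul_assoc]

theorem unit2_incl (S : IsActionBgd act coact ψ st cop cou) (h g : H) :
    BgdST.unit2 cou (incl ψ h) (incl ψ g) =
      algebraMap k B (counit (R := k) h * counit (R := k) g) := by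
  rw [BgdST.unit2, S.incl_mul_incl, S.cou_incl, Bialgebra.counit_mul, mul_comm]

theorem conv2_eq_unit2_iff (S : IsActionBgd act coact ψ st cop cou)
    (E : SLin st fun X Y => Γ X Y) (T : ∀ c X Y, Γ (st.t c * X) Y = Γ X Y * c)
    (M : ∀ c X Y, Γ (X * st.t c) Y = Γ X (st.t c * Y)) {F : L → L → B} (hF : SLin st F) :
    (∀ X Y, st.conv2 cop (fun X Y => Γ X Y) F X Y = BgdST.unit2 cou X Y) ↔ ∀ h g : H,
      convBB (k := k) (fun h g => Γ (incl ψ h) (incl ψ g)) (fun h g => F (incl ψ h) (incl ψ g))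
        h g = algebraMap k B (counit (R := k) h * counit (R := k) g) := by
  simp only [← S.conv2_incl T M hF, ← S.unit2_incl]
  exact ⟨fun h x y => h _ _, fun h => SLin.ext S (S.slin_conv2 E T M hF) S.slin_unit2 h⟩

theorem SLin.conv2_cancel (S : IsActionBgd act coact ψ st cop cou)
    (T : ∀ c X Y, Γ (st.t c * X) Y = Γ X Y * c)
    (M : ∀ c X Y, Γ (X * st.t c) Y = Γ X (st.t c * Y)) {γi : H →ₗ[k] H →ₗ[k] B}
    (hγi : ∀ h g, convBB (k := k) (fun h g => γi h g) (fun h g => Γ (incl ψ h) (incl ψ g)) h g =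
      algebraMap k B (counit (R := k) h * counit (R := k) g))
    {F G : L → L → B} (hF : SLin st F) (hG : SLin st G)
    (h : ∀ X Y, st.conv2 cop (fun X Y => Γ X Y) F X Y = st.conv2 cop (fun X Y => Γ X Y) G X Y)
    (X Y : L) : F X Y = G X Y := by
  refine SLin.ext S hF hG (fun x y => ?_) X Y
  refine convBB_left_cancel (α := Γ.compl₁₂ (incl ψ) (incl ψ))
    (β := (bilinOfLin hF.lin_left hF.lin_right).compl₁₂ (incl ψ) (incl ψ))
    (δ := (bilinOfLin hG.lin_left hG.lin_right).compl₁₂ (incl ψ) (incl ψ)) hγi (fun x y => ?_) x y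
  exact (S.conv2_incl T M hF x y).symm.trans ((h _ _).trans (S.conv2_incl T M hG x y))

theorem SLin.t_mul_left {F : L → L → B} (hF : SLin st F) (c : B) :
    SLin st fun X Y => F (st.t c * X) Y where
  lin_left Y := (hF.lin_left Y).comp (g := fun X => st.t c * X) (by fun_prop)
  lin_right X := hF.lin_right _
  s_mul a X Y := by rw [← mul_assoc, ← st.st_comm, mul_assoc, hF.s_mul]
  mul_s b X Y := by rw [← mul_assoc, hF.mul_s]

theorem SLin.mul_t_left {F : L → L → B} (hF : SLin st F) (c : B) :
    SLin st fun X Y => F (X * st.t c) Y where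
  lin_left Y := (hF.lin_left Y).comp (g := fun X => X * st.t c) (by fun_prop)
  lin_right X := hF.lin_right _
  s_mul a X Y := by rw [mul_assoc, hF.s_mul]
  mul_s b X Y := by rw [mul_assoc, st.st_comm, ← mul_assoc, hF.mul_s]

theorem SLin.t_mul_right {F : L → L → B} (hF : SLin st F) (c : B) :
    SLin st fun X Y => F X (st.t c * Y) where
  lin_left Y := hF.lin_left _
  lin_right X := (hF.lin_right X).comp (g := fun X => st.t c * X) (by fun_prop)
  s_mul a X Y := by rw [hF.s_mul]
  mul_s b X Y := by rw [hF.mul_s, ← mul_assoc, st.st_comm, mul_assoc]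

/-- The convolution inverse of a bimodule map is a bimodule map. -/
theorem isBihom_of_conv2 (S : IsActionBgd act coact ψ st cop cou)
    (T : ∀ c X Y, Γ (st.t c * X) Y = Γ X Y * c)
    (M : ∀ c X Y, Γ (X * st.t c) Y = Γ X (st.t c * Y)) {Γi : L →ₗ[k] L →ₗ[k] B}
    (Ei : SLin st fun X Y => Γi X Y)
    (h₁ : ∀ X Y, st.conv2 cop (fun X Y => Γ X Y) (fun X Y => Γi X Y) X Y = BgdST.unit2 cou X Y)
    (h₂ : ∀ h g : H, convBB (k := k) (fun h g => Γi (incl ψ h) (incl ψ g))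
      (fun h g => Γ (incl ψ h) (incl ψ g)) h g =
        algebraMap k B (counit (R := k) h * counit (R := k) g)) :
    st.IsBihom fun X Y => Γi X Y := by
  have hL := S.isBgd
  have hb := bal22_conv T M Ei
  have cancel := @SLin.conv2_cancel _ _ _ _ _ _ _ _ _ _ _ _ _ _ _ _ _ _ S T M
    (Γi.compl₁₂ (incl ψ) (incl ψ)) h₂
  refine isBihom_iff.2 ⟨Ei, fun c => cancel (Ei.t_mul_left c) (Ei.mul_const c) fun X Y => ?_,
    fun c => cancel (Ei.mul_t_left c) (Ei.t_mul_right c) fun X Y => ?_⟩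
  · refine ((hb.t_mul_left hL c X Y).symm.trans (h₁ _ _)).trans ?_
    rw [BgdST.unit2, mul_assoc, hL.counit_t]
    refine (congrArg (· * c) (h₁ X Y)).symm.trans ((hb.apply hL (φ := fun x => x * c)
      (by fun_prop) X Y).trans ?_)
    simp only [mul_assoc]
    rfl
  · refine ((hb.mul_t_left hL c X Y).symm.trans (h₁ _ _)).trans ?_
    rw [BgdST.unit2, mul_assoc]
    exact ((hb.t_mul_right hL c X Y).symm.trans (h₁ _ _)).symm

theorem inv_iff (S : IsActionBgd act coact ψ st cop cou) (E : SLin st fun X Y => Γ X Y)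
    (T : ∀ c X Y, Γ (st.t c * X) Y = Γ X Y * c)
    (M : ∀ c X Y, Γ (X * st.t c) Y = Γ X (st.t c * Y)) :
    (∃ Γi : L → L → B, st.IsBihom Γi ∧
      (∀ X Y, st.conv2 cop (fun X Y => Γ X Y) Γi X Y = BgdST.unit2 cou X Y) ∧
      ∀ X Y, st.conv2 cop Γi (fun X Y => Γ X Y) X Y = BgdST.unit2 cou X Y) ↔
    ∃ γi : H → H → B, (∃ γi' : H →ₗ[k] H →ₗ[k] B, ∀ h g, γi' h g = γi h g) ∧
      (∀ h g : H, convBB (k := k) (fun h g => Γ (incl ψ h) (incl ψ g)) γi h g =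
        algebraMap k B (counit (R := k) h * counit (R := k) g)) ∧
      ∀ h g : H, convBB (k := k) γi (fun h g => Γ (incl ψ h) (incl ψ g)) h g =
        algebraMap k B (counit (R := k) h * counit (R := k) g) := by
  constructor
  · rintro ⟨Γi', hi, h₁, h₂⟩
    obtain ⟨Γi, rfl⟩ : ∃ Γi : L →ₗ[k] L →ₗ[k] B, (fun X Y => Γi X Y) = Γi' :=
      hi.1.imp fun _ h => funext₂ h
    obtain ⟨Ei, Ti, Mi⟩ := isBihom_iff.1 hi
    exact ⟨fun h g => Γi (incl ψ h) (incl ψ g), ⟨Γi.compl₁₂ (incl ψ) (incl ψ), fun _ _ => rfl⟩,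
      (S.conv2_eq_unit2_iff E T M Ei).1 h₁, (S.conv2_eq_unit2_iff Ei Ti Mi E).1 h₂⟩
  · rintro ⟨γi', hi, h₁, h₂⟩
    obtain ⟨γi, rfl⟩ : ∃ γi : H →ₗ[k] H →ₗ[k] B, (fun h g => γi h g) = γi' :=
      hi.imp fun _ h => funext₂ h
    have Ei := S.slin_ext γi
    simp only [← S.ext_incl γi] at h₁ h₂
    have h₁' := (S.conv2_eq_unit2_iff E T M Ei).2 h₁
    have hb := S.isBihom_of_conv2 T M Ei h₁' h₂
    obtain ⟨-, Ti, Mi⟩ := isBihom_iff.1 hb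
    exact ⟨fun X Y => ext act ψ γi X Y, hb, h₁', (S.conv2_eq_unit2_iff Ei Ti Mi E).2 h₂⟩

theorem isZ2_iff (S : IsActionBgd act coact ψ st cop cou) (E : SLin st fun X Y => Γ X Y) :
    st.IsZ2 cop cou (fun X Y => Γ X Y) ↔
      IsZ2cross (fun b h => act b h) coact fun h g => Γ (incl ψ h) (incl ψ g) := by
  constructor
  · rintro ⟨hb, hl, hr, hI, hc, hi⟩
    obtain ⟨-, T, M⟩ := isBihom_iff.1 hb
    exact ⟨⟨⟨Γ.compl₁₂ (incl ψ) (incl ψ), fun _ _ => rfl⟩,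
      fun h => ⟨(S.norm_right_iff E).1 hr h, (S.norm_left_iff E).1 hl h⟩,
      (S.cocycle_iff E T M hI).1 hc, (S.st_indep_iff E T M).1 hI, (S.inv_iff E T M).1 hi⟩,
      (S.mul_t_iff E T).1 M, (S.t_mul_iff E).1 T⟩
  · rintro ⟨⟨-, hn, hc, hI, hi⟩, hM, hT⟩
    have T := (S.t_mul_iff E).2 hT
    have M := (S.mul_t_iff E T).2 hM
    have I := (S.st_indep_iff E T M).2 hI
    exact ⟨isBihom_iff.2 ⟨E, T, M⟩, (S.norm_left_iff E).2 fun h => (hn h).2,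
      (S.norm_right_iff E).2 fun h => (hn h).1, I, (S.cocycle_iff E T M I).2 hc,
      (S.inv_iff E T M).2 hi⟩

end IsActionBgd

section ConvHB

variable {k : Type u} [Field k] {H B : Type v} [Ring H] [HopfAlgebra k H] [Ring B] [Algebra k B]

theorem convHB_apply (α β : H →ₗ[k] B) (h : H) :
    convHB α β h = tlift k (fun h1 h2 => α h1 * β h2) (comul (R := k) h) := rfl

theorem unitBmap_apply (h : H) :
    unitBmap (k := k) (B := B) h = algebraMap k B (counit (R := k) h) := rfl

theorem convHB_assoc (α β δ : H →ₗ[k] B) : convHB α (convHB β δ) = convHB (convHB α β) δ := by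
  ext h
  simp only [convHB_apply]
  calc
    _ = tlift k (fun h1 h' => tlift k (fun h2 h3 => α h1 * (β h2 * δ h3)) (comul (R := k) h'))
          (comul (R := k) h) := by
      congr 2
      funext h1 h'
      rw [lin_apply_tlift (φ := fun x => α h1 * x) (by fun_prop)]
    _ = tlift k (fun h' h3 => tlift k (fun h1 h2 => α h1 * (β h2 * δ h3)) (comul (R := k) h'))
          (comul (R := k) h) := (tlift_coassoc (f := fun h1 h2 h3 => α h1 * (β h2 * δ h3)) h).symm
    _ = _ := by
      congr 2
      funext h' h3
      rw [lin_apply_tlift (φ := fun x => x * δ h3) (by fun_prop)]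
      simp only [mul_assoc]

theorem convHB_unitBmap_left (α : H →ₗ[k] B) : convHB unitBmap α = α := by
  ext h
  simp only [convHB_apply, unitBmap_apply, ← Algebra.smul_def]
  exact tlift_counit_left (f := fun h => α h) h

theorem convHB_left_cancel {α αi β δ : H →ₗ[k] B} (hα : convHB αi α = unitBmap)
    (h : convHB α β = convHB α δ) : β = δ := by
  rw [← convHB_unitBmap_left β, ← convHB_unitBmap_left δ, ← hα, ← convHB_assoc, h, convHB_assoc]

end ConvHB

namespace IsActionBgd

variable {k : Type u} [Field k] {H B L : Type v} [Ring H] [HopfAlgebra k H] [Ring B]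
  [Algebra k B] [Ring L] [Algebra k L] {act : B →ₗ[k] H →ₗ[k] B}
  {coact : B →ₗ[k] B ⊗[k] H} {ψ : L ≃ₗ[k] B ⊗[k] H} {st : BgdST k B L} {cop : L →ₗ[k] st.T2}
  {cou : L →ₗ[k] B} {U V W : L →ₗ[k] B}

theorem linearMap_ext (S : IsActionBgd act coact ψ st cop cou)
    (hU : ∀ b X, U (st.s b * X) = b * U X) (hV : ∀ b X, V (st.s b * X) = b * V X)
    (h : ∀ x, U (incl ψ x) = V (incl ψ x)) : U = V :=
  LinearMap.ext <| S.lin_ext (by fun_prop) (by fun_prop) fun a x => by rw [hU, hV, h]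

/-- The extension `a # h ↦ a ϱ(h)` of `ϱ` to `B # H^op`. -/
def ext₁ (ψ : L ≃ₗ[k] B ⊗[k] H) (ϱ : H →ₗ[k] B) : L →ₗ[k] B :=
  tlift k (fun a h => a * ϱ h) ∘ₗ ψ.toLinearMap

theorem ext₁_s_mul_incl (S : IsActionBgd act coact ψ st cop cou) (ϱ : H →ₗ[k] B) (a : B) (h : H) :
    ext₁ ψ ϱ (st.s a * incl ψ h) = a * ϱ h := by
  rw [S.s_mul_incl, ext₁, LinearMap.comp_apply, LinearEquiv.coe_coe, ψ.apply_symm_apply,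
    tlift_tmul]

theorem ext₁_incl (S : IsActionBgd act coact ψ st cop cou) (ϱ : H →ₗ[k] B) (h : H) :
    ext₁ ψ ϱ (incl ψ h) = ϱ h := by
  have := S.ext₁_s_mul_incl ϱ 1 h
  rwa [_root_.map_one, one_mul, one_mul] at this

theorem ext₁_comp_incl (S : IsActionBgd act coact ψ st cop cou) (ϱ : H →ₗ[k] B) :
    ext₁ ψ ϱ ∘ₗ incl ψ = ϱ :=
  LinearMap.ext (S.ext₁_incl ϱ)

theorem ext₁_s_mul (S : IsActionBgd act coact ψ st cop cou) (ϱ : H →ₗ[k] B) (b : B) (X : L) :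
    ext₁ ψ ϱ (st.s b * X) = b * ext₁ ψ ϱ X := by
  refine S.lin_ext (f := fun X => ext₁ ψ ϱ (st.s b * X)) (g := fun X => b * ext₁ ψ ϱ X)
    (by fun_prop) (by fun_prop) (fun a h => ?_) X
  rw [← mul_assoc, ← _root_.map_mul, S.ext₁_s_mul_incl, S.ext₁_s_mul_incl, mul_assoc]

theorem t_mul_iff₁ (S : IsActionBgd act coact ψ st cop cou)
    (hU : ∀ b X, U (st.s b * X) = b * U X) :
    (∀ b X, U (st.t b * X) = U X * b) ↔ ∀ (h : H) (b : B),
      tlift k (fun b0 b1 => b0 * (U ∘ₗ incl ψ) (h * b1)) (coact b) = (U ∘ₗ incl ψ) h * b := by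
  have key : ∀ (h : H) (b : B), U (st.t b * incl ψ h) =
      tlift k (fun b0 b1 => b0 * (U ∘ₗ incl ψ) (h * b1)) (coact b) := fun h b => by
    rw [S.t_mul_incl, lin_apply_tlift (φ := U) (by fun_prop)]
    simp only [hU, LinearMap.comp_apply]
  simp only [← key]
  refine ⟨fun h x b => h b _, fun h b => S.lin_ext (by fun_prop) (by fun_prop) fun a x => ?_⟩
  rw [← mul_assoc, ← st.st_comm, mul_assoc, hU, hU, h, mul_assoc, LinearMap.comp_apply]

theorem apply_incl_mul_t (S : IsActionBgd act coact ψ st cop cou)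
    (hU : ∀ b X, U (st.t b * X) = U X * b) (h : H) (b : B) :
    U (incl ψ h * st.t b) =
      tlift k (fun h1 h2 => (U ∘ₗ incl ψ) h1 * act b h2) (comul (R := k) h) := by
  rw [S.incl_mul_t, lin_apply_tlift (φ := U) (by fun_prop)]
  simp only [hU, LinearMap.comp_apply]

theorem vertical_iff (S : IsActionBgd act coact ψ st cop cou)
    (hU : ∀ b X, U (st.s b * X) = b * U X) (hU' : ∀ b X, U (st.t b * X) = U X * b) :
    (∀ b X, U (X * st.s b) = U (X * st.t b)) ↔ ∀ (h : H) (b : B),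
      tlift k (fun h1 h2 => (U ∘ₗ incl ψ) h1 * act b h2) (comul (R := k) h) =
      tlift k (fun h1 h2 => act b h1 * (U ∘ₗ incl ψ) h2) (comul (R := k) h) := by
  have key : ∀ (h : H) (b : B), U (incl ψ h * st.s b) =
      tlift k (fun h1 h2 => act b h1 * (U ∘ₗ incl ψ) h2) (comul (R := k) h) := fun h b => by
    rw [S.incl_mul_s, lin_apply_tlift (φ := U) (by fun_prop)]
    simp only [hU, LinearMap.comp_apply]
  simp only [← S.apply_incl_mul_t hU', ← key]
  refine ⟨fun h x b => (h b _).symm, fun h b => S.lin_ext (by fun_prop) (by fun_prop) fun a x => ?_⟩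
  rw [mul_assoc, mul_assoc, hU, hU, h]

theorem bal_cconv (hU : ∀ b X, U (st.t b * X) = U X * b)
    (hV : ∀ b X, V (st.s b * X) = b * V X) : st.Bal fun x y => U x * V y where
  bal a x y := by rw [hU, hV, mul_assoc]

theorem cconv_s_mul (S : IsActionBgd act coact ψ st cop cou) (hU : st.IsBimodMap U)
    (hV : ∀ b X, V (st.s b * X) = b * V X) (b : B) (X : L) :
    st.cconv cop U V (st.s b * X) = b * st.cconv cop U V X := by
  refine (S.isBgd.lift2_s_mul (bal_cconv hU.1 hV) b X).trans ?_
  simp only [hU.2, mul_assoc]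
  exact (BgdST.lin_apply_lift2 (φ := fun x => b * x) (by fun_prop) (bal_cconv hU.1 hV) _).symm

theorem cconv_comp_incl (S : IsActionBgd act coact ψ st cop cou)
    (hU : ∀ b X, U (st.t b * X) = U X * b) (hV : ∀ b X, V (st.s b * X) = b * V X) :
    st.cconv cop U V ∘ₗ incl ψ = convHB (U ∘ₗ incl ψ) (V ∘ₗ incl ψ) :=
  LinearMap.ext fun h => S.lift2_cop_incl (bal_cconv hU hV) h

theorem cconv_eq_cou_iff (S : IsActionBgd act coact ψ st cop cou) (hU : st.IsBimodMap U)
    (hV : ∀ b X, V (st.s b * X) = b * V X) :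
    st.cconv cop U V = cou ↔ convHB (U ∘ₗ incl ψ) (V ∘ₗ incl ψ) = unitBmap := by
  have hcou : cou ∘ₗ incl ψ = unitBmap := LinearMap.ext S.cou_incl
  rw [← S.cconv_comp_incl hU.1 hV, ← hcou]
  exact ⟨fun h => by rw [h], fun h => S.linearMap_ext (S.cconv_s_mul hU hV)
    S.isLeftBialgebroid.counit_s (LinearMap.congr_fun h)⟩

theorem cconv_left_cancel (S : IsActionBgd act coact ψ st cop cou) (hU : st.IsBimodMap U)
    {ϱi : H →ₗ[k] B} (hϱi : convHB ϱi (U ∘ₗ incl ψ) = unitBmap)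
    (hV : ∀ b X, V (st.s b * X) = b * V X) (hW : ∀ b X, W (st.s b * X) = b * W X)
    (h : ∀ X, st.cconv cop U V X = st.cconv cop U W X) : V = W := by
  refine S.linearMap_ext hV hW (LinearMap.congr_fun (f := V ∘ₗ incl ψ) (g := W ∘ₗ incl ψ) ?_)
  refine convHB_left_cancel hϱi ?_
  rw [← S.cconv_comp_incl hU.1 hV, ← S.cconv_comp_incl hU.1 hW, LinearMap.ext h]

/-- The convolution inverse of a bimodule map is a bimodule map. -/
theorem isBimodMap_of_cconv (S : IsActionBgd act coact ψ st cop cou) (hU : st.IsBimodMap U)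
    (hV : ∀ b X, V (st.s b * X) = b * V X) (h₁ : st.cconv cop U V = cou)
    (h₂ : convHB (V ∘ₗ incl ψ) (U ∘ₗ incl ψ) = unitBmap) : st.IsBimodMap V := by
  refine ⟨fun b => LinearMap.congr_fun (f := V ∘ₗ LinearMap.mulLeft k (st.t b))
    (g := LinearMap.mulRight k b ∘ₗ V) ?_, hV⟩
  have hb := bal_cconv hU.1 hV
  refine S.cconv_left_cancel hU h₂ (fun c X => ?_) (fun c X => ?_) fun X => ?_
  · simp only [LinearMap.comp_apply, LinearMap.mulLeft_apply]
    rw [← mul_assoc, ← st.st_comm, mul_assoc, hV]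
  · simp only [LinearMap.comp_apply, LinearMap.mulRight_apply, hV, mul_assoc]
  · refine ((S.isBgd.lift2_t_mul hb b X).symm.trans (LinearMap.congr_fun h₁ _)).trans ?_
    rw [S.isLeftBialgebroid.counit_t, ← h₁]
    refine (BgdST.lin_apply_lift2 (φ := fun x => x * b) (by fun_prop) hb _).trans ?_
    simp only [mul_assoc]
    rfl

/-- The convolution inverse of a vertical map is vertical. -/
theorem vertical_of_cconv (S : IsActionBgd act coact ψ st cop cou) (hU : st.IsBimodMap U)
    (hUv : ∀ b X, U (X * st.s b) = U (X * st.t b)) (hV : ∀ b X, V (st.s b * X) = b * V X)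
    (h₁ : st.cconv cop U V = cou) (h₂ : convHB (V ∘ₗ incl ψ) (U ∘ₗ incl ψ) = unitBmap) (b : B)
    (X : L) : V (X * st.s b) = V (X * st.t b) := by
  revert X
  refine LinearMap.congr_fun (f := V ∘ₗ LinearMap.mulRight k (st.s b))
    (g := V ∘ₗ LinearMap.mulRight k (st.t b)) ?_
  have hb := bal_cconv hU.1 hV
  refine S.cconv_left_cancel hU h₂ (fun c X => ?_) (fun c X => ?_) fun X => ?_
  · simp only [LinearMap.comp_apply, LinearMap.mulRight_apply, mul_assoc, hV]
  · simp only [LinearMap.comp_apply, LinearMap.mulRight_apply, mul_assoc, hV]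
  · refine (S.isBgd.lift2_takeuchi hb b X).symm.trans ?_
    simp only [← hUv]
    refine (S.isBgd.lift2_mul_s hb b X).symm.trans ((LinearMap.congr_fun h₁ _).trans ?_)
    refine Eq.trans ?_ ((LinearMap.congr_fun h₁ _).symm.trans (S.isBgd.lift2_mul_t hb b X))
    have := S.isLeftBialgebroid.counit_char_t X (st.s b)
    have hs : cou (st.s b) = b := by
      have := S.isLeftBialgebroid.counit_s b 1
      rwa [mul_one, S.isLeftBialgebroid.counit_one, mul_one] at this
    rw [← this, hs]

/-- `lift2` of an expression that is not balanced vanishes. -/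
theorem _root_.BgdST.bal_of_lift2_ne_zero {Q : Type*} [AddCommGroup Q] [Module k Q] {f : L → L → Q}
    (hf : st.lift2 f ≠ 0) (a : B) (x y : L) : f (st.t a * x) y = f x (st.s a * y) := by
  unfold BgdST.lift2 qtlift at hf
  split_ifs at hf with h
  · obtain ⟨F, hF⟩ := h
    rw [← hF, ← hF]
    exact congrArg F (BgdST.mk2_t_mul a x y)
  · exact absurd rfl hf

theorem lift2_ne_zero_of_cconv [Nontrivial B] (hL : st.IsLeftBialgebroid cop cou)
    (h : st.cconv cop U V = cou) : st.lift2 (fun x y => U x * V y) ≠ 0 := by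
  intro h₀
  have h₁ := hL.counit_one
  rw [← h, BgdST.cconv, h₀] at h₁
  exact zero_ne_one h₁

theorem isBimodMap_of_isC1 (S : IsActionBgd act coact ψ st cop cou) (hU : st.IsC1 cop cou U)
    (h₁ : st.cconv cop U V = cou) (h₂ : st.cconv cop V U = cou) : st.IsBimodMap V := by
  rcases subsingleton_or_nontrivial B with _ | _
  · exact ⟨fun _ _ => Subsingleton.elim _ _, fun _ _ => Subsingleton.elim _ _⟩
  · have hs := BgdST.bal_of_lift2_ne_zero (lift2_ne_zero_of_cconv S.isLeftBialgebroid h₁)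
    have ht := BgdST.bal_of_lift2_ne_zero (lift2_ne_zero_of_cconv S.isLeftBialgebroid h₂)
    refine ⟨fun b X => ?_, fun b X => ?_⟩
    · have := ht b X 1
      rwa [hU.2.1.2, hU.1, mul_one, mul_one] at this
    · have := hs b 1 X
      rwa [hU.2.1.1, hU.1, one_mul, one_mul, eq_comm] at this

theorem isC1ver_comp_incl (S : IsActionBgd act coact ψ st cop cou) (hU : st.IsC1 cop cou U) :
    IsC1ver (fun b h => act b h) coact (U ∘ₗ incl ψ) := by
  obtain ⟨h1, hb, hv, V, hV, h₁, h₂⟩ := hU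
  refine ⟨?_, (S.t_mul_iff₁ hb.2).1 hb.1, (S.vertical_iff hb.2 hb.1).1 hv, V ∘ₗ incl ψ,
    (S.cconv_eq_cou_iff hb hV.2).1 h₁, (S.cconv_eq_cou_iff hV hb.2).1 h₂⟩
  rw [LinearMap.comp_apply, S.incl_one, h1]

theorem isC1_ext₁ (S : IsActionBgd act coact ψ st cop cou) {ϱ ϱi : H →ₗ[k] B}
    (hϱ : IsC1ver (fun b h => act b h) coact ϱ) (h₁ : convHB ϱ ϱi = unitBmap)
    (h₂ : convHB ϱi ϱ = unitBmap) :
    st.IsC1 cop cou (ext₁ ψ ϱ) ∧ st.cconv cop (ext₁ ψ ϱ) (ext₁ ψ ϱi) = cou ∧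
      st.cconv cop (ext₁ ψ ϱi) (ext₁ ψ ϱ) = cou := by
  obtain ⟨hone, ht, hv, -⟩ := hϱ
  rw [← S.ext₁_comp_incl ϱ] at ht hv
  rw [← S.ext₁_comp_incl ϱ, ← S.ext₁_comp_incl ϱi] at h₁ h₂
  have hb : st.IsBimodMap (ext₁ ψ ϱ) := ⟨(S.t_mul_iff₁ (S.ext₁_s_mul ϱ)).2 ht, S.ext₁_s_mul ϱ⟩
  have h₁' := (S.cconv_eq_cou_iff hb (S.ext₁_s_mul ϱi)).2 h₁
  have hbi := S.isBimodMap_of_cconv hb (S.ext₁_s_mul ϱi) h₁' h₂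
  have h₂' := (S.cconv_eq_cou_iff hbi hb.2).2 h₂
  refine ⟨⟨?_, hb, (S.vertical_iff hb.2 hb.1).2 hv, _, hbi, h₁', h₂'⟩, h₁', h₂'⟩
  rw [← S.incl_one, S.ext₁_incl, hone]

section GammaU

variable {Γ : L →ₗ[k] L →ₗ[k] B} {Ui : L →ₗ[k] B}

theorem slin_mul (hU : ∀ b X, U (st.s b * X) = b * U X) : SLin st fun X Y => U (X * Y) where
  s_mul a X Y := by rw [mul_assoc, hU]
  mul_s b X Y := by rw [mul_assoc]

theorem bal22_gammaU (hUi : st.IsBimodMap Ui) {K : L → L → B} (hK : SLin st K) :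
    st.Bal22 fun x1 y1 x2 y2 => Ui (x1 * st.t (Ui y1)) * K x2 y2 where
  lin₃ x1 y1 y2 := (hK.lin_left y2).const_mul _
  lin₄ x1 y1 x2 := (hK.lin_right x2).const_mul _
  bal a x1 y1 x2 y2 := by rw [mul_assoc, hUi.1, hK.s_mul, mul_assoc]
  t_mul a x1 y1 x2 y2 := by rw [hUi.1, st.t_mul, mul_assoc x1]
  s_mul a x1 y1 x2 y2 := by rw [hK.mul_s]

theorem gammaU_eq_lift22 (S : IsActionBgd act coact ψ st cop cou) (E : SLin st fun X Y => Γ X Y)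
    (T : ∀ c X Y, Γ (st.t c * X) Y = Γ X Y * c)
    (M : ∀ c X Y, Γ (X * st.t c) Y = Γ X (st.t c * Y)) (hU : st.IsBimodMap U)
    (hUi : st.IsBimodMap Ui) (X Y : L) :
    st.gammaU cop (fun X Y => Γ X Y) U Ui X Y = st.lift22 cop (fun x1 y1 x23 y23 =>
      Ui (x1 * st.t (Ui y1)) *
        st.conv2 cop (fun X Y => Γ X Y) (fun X Y => U (X * Y)) x23 y23) X Y := by
  have hb := bal22_conv T M (slin_mul hU.2)
  have hbc (c : B) : st.Bal22 fun x2 y2 x3 y3 => c * Γ x2 y2 * U (x3 * y3) := by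
    simp only [mul_assoc c]
    exact ⟨by fun_prop, by fun_prop, by fun_prop, by fun_prop,
      fun a x1 y1 x2 y2 => congrArg (c * ·) (hb.bal a x1 y1 x2 y2),
      fun a x1 y1 x2 y2 => congrArg (c * ·) (hb.t_mul a x1 y1 x2 y2),
      fun a x1 y1 x2 y2 => congrArg (c * ·) (hb.s_mul a x1 y1 x2 y2)⟩
  unfold BgdST.gammaU BgdST.lift22
  congr 2
  funext y1 y23
  rw [BgdST.lift2_comm (fun x1 x23 => (hbc _).bal_outer S.isBgd x23) fun y2 y3 => ?_]
  · congr 2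
    funext x1 x23
    refine Eq.trans ?_
      (hb.apply S.isBgd (φ := fun x => Ui (x1 * st.t (Ui y1)) * x) (by fun_prop) x23 y23).symm
    simp only [mul_assoc]
    rfl
  · refine ⟨fun x23 => BgdST.lin_lift2_fun _ (by fun_prop) fun x1 => (hbc _).bal_inner _ _,
      by fun_prop, fun a x1 x23 => ?_⟩
    rw [S.isBgd.lift2_s_mul ((hbc _).bal_inner _ _)]
    simp only [E.s_mul, mul_assoc, hUi.1]

theorem slin_gammaU (S : IsActionBgd act coact ψ st cop cou) (E : SLin st fun X Y => Γ X Y)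
    (T : ∀ c X Y, Γ (st.t c * X) Y = Γ X Y * c)
    (M : ∀ c X Y, Γ (X * st.t c) Y = Γ X (st.t c * Y)) (hU : st.IsBimodMap U)
    (hUi : st.IsBimodMap Ui) (hv : ∀ b X, Ui (X * st.s b) = Ui (X * st.t b)) :
    SLin st (st.gammaU cop (fun X Y => Γ X Y) U Ui) := by
  have hb := bal22_gammaU hUi (S.slin_conv2 E T M (slin_mul hU.2))
  rw [funext₂ (S.gammaU_eq_lift22 E T M hU hUi)]
  refine ⟨hb.lin_left S.isBgd, BgdST.Bal22.lin_right _, fun a X Y => ?_, fun b X Y => ?_⟩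
  · rw [hb.s_mul_left S.isBgd, hb.apply S.isBgd (φ := fun x => a * x) (by fun_prop)]
    simp only [mul_assoc, hUi.2]
  · rw [hb.mul_s_left S.isBgd, hb.s_mul_right S.isBgd]
    simp only [hUi.2, st.t_mul, mul_assoc, st.st_comm]
    simp only [← mul_assoc, hv]

theorem gammaU_incl (S : IsActionBgd act coact ψ st cop cou) (E : SLin st fun X Y => Γ X Y)
    (T : ∀ c X Y, Γ (st.t c * X) Y = Γ X Y * c)
    (M : ∀ c X Y, Γ (X * st.t c) Y = Γ X (st.t c * Y)) (hU : st.IsBimodMap U)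
    (hUi : st.IsBimodMap Ui) (h g : H) :
    st.gammaU cop (fun X Y => Γ X Y) U Ui (incl ψ h) (incl ψ g) =
      gamRho (k := k) (fun b h => act b h) (U ∘ₗ incl ψ) (Ui ∘ₗ incl ψ)
        (fun h g => Γ (incl ψ h) (incl ψ g)) h g := by
  rw [S.gammaU_eq_lift22 E T M hU hUi,
    S.lift22_incl (bal22_gammaU hUi (S.slin_conv2 E T M (slin_mul hU.2)))]
  simp only [S.conv2_incl T M (slin_mul hU.2), S.apply_incl_mul_t hUi.1, convBB, S.incl_mul_incl]
  unfold gamRho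
  rw [← tlift_coassoc (f := fun h1 h2 h34 => tlift k (fun h3 h4 =>
    tlift k (fun g1 g23 => tlift k (fun g2 g3 =>
      (Ui ∘ₗ incl ψ) h1 * act ((Ui ∘ₗ incl ψ) g1) h2 * Γ (incl ψ h3) (incl ψ g2) *
        (U ∘ₗ incl ψ) (g3 * h4)) (comul (R := k) g23)) (comul (R := k) g))
    (comul (R := k) h34)), tlift_comm]
  congr 2
  funext h' h34
  simp only [LinearMap.comp_apply]
  calc
    _ = tlift k (fun g1 g23 => tlift k (fun h1 h2 => tlift k (fun h3 h4 => tlift k (fun g2 g3 =>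
          Ui (incl ψ h1) * act (Ui (incl ψ g1)) h2 * Γ (incl ψ h3) (incl ψ g2) *
            U (incl ψ (g3 * h4))) (comul (R := k) g23)) (comul (R := k) h34)) (comul (R := k) h'))
          (comul (R := k) g) := by
      congr 2
      funext g1 g23
      rw [lin_apply_tlift (φ := fun x => x * _) (by fun_prop)]
      congr 2
      funext h1 h2
      rw [lin_apply_tlift (φ := fun x => Ui (incl ψ h1) * act (Ui (incl ψ g1)) h2 * x)
        (by fun_prop)]
      congr 2
      funext h3 h4
      rw [lin_apply_tlift (φ := fun x => Ui (incl ψ h1) * act (Ui (incl ψ g1)) h2 * x)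
        (by fun_prop)]
      simp only [mul_assoc]
    _ = _ := by
      rw [tlift_comm]
      congr 2
      funext h1 h2
      rw [tlift_comm]

end GammaU

end IsActionBgd

namespace IsActionBgd

variable {k : Type u} [Field k] {H B L : Type v} [Ring H] [HopfAlgebra k H] [Ring B]
  [Algebra k B] [Ring L] [Algebra k L] {act : B →ₗ[k] H →ₗ[k] B}
  {coact : B →ₗ[k] B ⊗[k] H} {ψ : L ≃ₗ[k] B ⊗[k] H} {st : BgdST k B L} {cop : L →ₗ[k] st.T2}
  {cou : L →ₗ[k] B}

theorem slin_of_isZ2 {Γ : L → L → B} (hΓ : st.IsZ2 cop cou Γ) : SLin st Γ := by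
  obtain ⟨Γ', h⟩ := hΓ.bihom.1
  obtain rfl : (fun X Y => Γ' X Y) = Γ := funext₂ h
  exact (isBihom_iff.1 hΓ.bihom).1

/-- Two-cocycles on `B # H^op` correspond to their restrictions to `H`. -/
def z2Equiv (S : IsActionBgd act coact ψ st cop cou) :
    {γ : H → H → B // IsZ2cross (fun b h => act b h) coact γ} ≃
      {Γ : L → L → B // st.IsZ2 cop cou Γ} where
  toFun γ := ⟨gammaSmash (fun b h => act b h) ψ γ.1, by
    obtain ⟨γ, hγ⟩ := γ
    obtain ⟨γ', h⟩ := hγ.1.1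
    obtain rfl : (fun x y => γ' x y) = γ := funext₂ h
    refine (S.isZ2_iff (S.slin_ext γ')).2 ?_
    simpa only [S.ext_incl] using hγ⟩
  invFun Γ := ⟨fun h g => Γ.1 (incl ψ h) (incl ψ g), by
    obtain ⟨Γ, hΓ⟩ := Γ
    obtain ⟨Γ', h⟩ := hΓ.bihom.1
    obtain rfl : (fun X Y => Γ' X Y) = Γ := funext₂ h
    exact (S.isZ2_iff (slin_of_isZ2 hΓ)).1 hΓ⟩
  left_inv γ := by
    obtain ⟨γ, hγ⟩ := γ
    obtain ⟨γ', h⟩ := hγ.1.1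
    obtain rfl : (fun x y => γ' x y) = γ := funext₂ h
    exact Subtype.ext (funext₂ (S.ext_incl γ'))
  right_inv Γ := by
    obtain ⟨Γ, hΓ⟩ := Γ
    obtain ⟨Γ', h⟩ := hΓ.bihom.1
    obtain rfl : (fun X Y => Γ' X Y) = Γ := funext₂ h
    exact Subtype.ext (funext₂ fun X Y => (S.eq_ext (γ := Γ'.compl₁₂ (incl ψ) (incl ψ))
      (slin_of_isZ2 hΓ) (fun _ _ => rfl) X Y).symm)

/-- Two cocycles are related by `C¹(B # H^op, B)` iff their restrictions to `H` are related by
`C¹_{◁,ver}(H, B)`. -/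
theorem gammaU_iff (S : IsActionBgd act coact ψ st cop cou) {Γ₁ Γ₂ : L → L → B}
    (h₁ : st.IsZ2 cop cou Γ₁) (h₂ : st.IsZ2 cop cou Γ₂) :
    (∃ ϱ ϱi : H →ₗ[k] B, IsC1ver (fun b h => act b h) coact ϱ ∧
      convHB ϱ ϱi = unitBmap ∧ convHB ϱi ϱ = unitBmap ∧
      ∀ h g : H, Γ₂ (incl ψ h) (incl ψ g) = gamRho (k := k) (fun b h => act b h) ϱ ϱi
        (fun h g => Γ₁ (incl ψ h) (incl ψ g)) h g) ↔
    ∃ U Ui : L →ₗ[k] B, st.IsC1 cop cou U ∧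
      st.cconv cop U Ui = cou ∧ st.cconv cop Ui U = cou ∧
      ∀ X Y : L, Γ₂ X Y = st.gammaU cop Γ₁ U Ui X Y := by
  have E₂ := slin_of_isZ2 h₂
  obtain ⟨Γ, h⟩ := h₁.bihom.1
  obtain rfl : (fun X Y => Γ X Y) = Γ₁ := funext₂ h
  obtain ⟨E, T, M⟩ := isBihom_iff.1 h₁.bihom
  constructor
  · rintro ⟨ϱ, ϱi, hϱ, hr, hl, hγ⟩
    obtain ⟨hU, hr', hl'⟩ := S.isC1_ext₁ hϱ hr hl
    have hUi := S.isBimodMap_of_isC1 hU hr' hl'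
    refine ⟨ext₁ ψ ϱ, ext₁ ψ ϱi, hU, hr', hl', SLin.ext S E₂
      (S.slin_gammaU E T M hU.2.1 hUi (S.vertical_of_cconv hU.2.1 hU.2.2.1 hUi.2 hr' ?_))
      fun x y => ?_⟩
    · rw [S.ext₁_comp_incl, S.ext₁_comp_incl, hl]
    · rw [S.gammaU_incl E T M hU.2.1 hUi, S.ext₁_comp_incl, S.ext₁_comp_incl, hγ]
  · rintro ⟨U, Ui, hU, hr, hl, hΓ⟩
    have hUi := S.isBimodMap_of_isC1 hU hr hl
    refine ⟨U ∘ₗ incl ψ, Ui ∘ₗ incl ψ, S.isC1ver_comp_incl hU,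
      (S.cconv_eq_cou_iff hU.2.1 hUi.2).1 hr, (S.cconv_eq_cou_iff hUi hU.2.1.2).1 hl,
      fun x y => ?_⟩
    rw [hΓ, S.gammaU_incl E T M hU.2.1 hUi]

end IsActionBgd

end

/-- For a braided-commutative right-right `H`-crossed module algebra `B`,
`H²_◁(H,B) ≅ H²(B # H^{op}, B)`: the classes of `Z²_◁(H,B)` modulo `γ ↦ γ^ϱ`
(`ϱ ∈ C¹_{◁,ver}(H,B)`) are in bijection with the classes of `Z²(B#H^{op},B)` modulo
`Γ ↦ Γ^U` (`U ∈ C¹(B#H^{op},B)`), compatibly with `γ ↦ Γ_γ`. -/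
theorem H2cross_iso_H2
    {k : Type u} [Field k] {H : Type v} [Ring H] [HopfAlgebra k H]
    {B : Type v} [Ring B] [Algebra k B]
    (hS : Function.Bijective (HopfAlgebra.antipode (R := k) (A := H)))
    (act : B → H → B) (coact : B → B ⊗[k] H)
    (hcross : IsRRCrossed act coact) (hbr : IsBraidedComm act coact)
    {L0 : Type v} [Ring L0] [Algebra k L0] (ψ : L0 ≃ₗ[k] B ⊗[k] H)
    (hψ1 : ψ 1 = 1) (hψm : ∀ x y : L0, ψ (x * y) = smashMul act (ψ x) (ψ y))
    (st : BgdST k B L0) (cop : L0 →ₗ[k] st.T2) (cou : L0 →ₗ[k] B)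
    (hbgd : st.IsLeftBialgebroid cop cou)
    (hsψ : ∀ b : B, st.s b = ψ.symm (b ⊗ₜ[k] (1 : H)))
    (htψ : ∀ b : B, st.t b = ψ.symm (coact b))
    (hcouψ : ∀ z : L0, cou z =
      tlift k (fun a h => (Coalgebra.counit (R := k) h : k) • a) (ψ z))
    (hcopψ : ∀ z : L0, cop z =
      tlift k (fun a h => tlift k (fun h1 h2 => st.mk2 (ψ.symm (a ⊗ₜ[k] h1))
        (ψ.symm ((1 : B) ⊗ₜ[k] h2))) (Coalgebra.comul (R := k) h)) (ψ z)) :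
    ∃ e : Quot (fun (γ1 γ2 : {γ : H → H → B // IsZ2cross act coact γ}) =>
        ∃ ϱ ϱi : H →ₗ[k] B, IsC1ver act coact ϱ ∧
          convHB ϱ ϱi = unitBmap ∧ convHB ϱi ϱ = unitBmap ∧
          ∀ h g : H, γ2.1 h g = gamRho (k := k) act (⇑ϱ) (⇑ϱi) γ1.1 h g) ≃
      Quot (fun (Γ1 Γ2 : {Γ : L0 → L0 → B // st.IsZ2 cop cou Γ}) =>
        ∃ U Ui : L0 →ₗ[k] B, st.IsC1 cop cou U ∧
          st.cconv cop U Ui = cou ∧ st.cconv cop Ui U = cou ∧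
          ∀ X Y : L0, Γ2.1 X Y = st.gammaU cop Γ1.1 U Ui X Y),
      ∀ (γs : {γ : H → H → B // IsZ2cross act coact γ})
        (Γs : {Γ : L0 → L0 → B // st.IsZ2 cop cou Γ}),
        (∀ z w : L0, Γs.1 z w = gammaSmash act ψ γs.1 z w) →
        e (Quot.mk _ γs) = Quot.mk _ Γs := by
  obtain ⟨⟨act', hact⟩, ⟨coact', hcoact⟩, h1, h2, h3, h4, -, -, -, -, h5⟩ := hcross
  obtain rfl : (fun b h => act' b h) = act := funext₂ hact
  obtain rfl : ⇑coact' = coact := funext hcoact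
  have S : IsActionBgd act' coact' ψ st cop cou :=
    ⟨h1, h2, h3, h4, h5, hψ1, hψm, hbgd, hsψ, htψ, hcouψ, hcopψ⟩
  refine ⟨Quot.congr S.z2Equiv fun γ₁ γ₂ => ?_, fun γs Γs h => congrArg (Quot.mk _)
    (Subtype.ext (funext₂ h)).symm⟩
  obtain ⟨Γ₁, rfl⟩ := S.z2Equiv.symm.surjective γ₁
  obtain ⟨Γ₂, rfl⟩ := S.z2Equiv.symm.surjective γ₂
  rw [S.z2Equiv.apply_symm_apply, S.z2Equiv.apply_symm_apply]
  exact S.gammaU_iff Γ₁.2 Γ₂.2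
end

section
/- Let H be a finite-dimensional Hopf algebra and H* its dual, regarded as a braided-commutative right-right H-crossed module algebra via a ◁ h = ⟨a₍₁₎, h⟩ a₍₂₎ and the coaction determined by (id ⊗ b)(Δ_R a) = b₍₁₎ a S(b₍₂₎) for all b ∈ H*. Then Z¹_◁(H,H*) can be identified with the set of counital invertible elements α ∈ H*, via ϱ(h) = ⟨α₍₁₎, h⟩ α₍₂₎ α⁻¹; the associated map ψ(a) = α a α⁻¹ is automatically bijective and counital, and under this identification the group product of Z¹_◁(H,H*) is multiplication in H* (so the identification is a group isomorphism onto the group of counital invertible elements of H*). -/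
open scoped TensorProduct
open TensorProduct

noncomputable section
attribute [local instance] Classical.propDecidable

variable (k : Type*) [Field k]

end

/-! ## Crossed (Drinfeld–Yetter) module algebras and action Hopf algebroids -/

noncomputable section
attribute [local instance] Classical.propDecidable

universe u v

open scoped TensorProduct
open TensorProduct

variable {k : Type u} [Field k] {H : Type v} [Ring H] [HopfAlgebra k H]
  {B : Type v} [Ring B] [Algebra k B]

end

/-! ## Dually paired Hopf algebras -/

noncomputable section
attribute [local instance] Classical.propDecidable
universe u2 v2
open scoped TensorProduct
open TensorProduct

variable {k : Type u2} [Field k] {H Hs : Type v2} [Ring H] [HopfAlgebra k H]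
  [Ring Hs] [HopfAlgebra k Hs]

/-- The right action of `H` on its dual: `a ◁ h = ⟨a₁, h⟩ a₂`. -/
def dualAct (pair : Hs →ₗ[k] H →ₗ[k] k) (a : Hs) (h : H) : Hs :=
  tlift k (fun a1 a2 => (pair a1 h : k) • a2) (Coalgebra.comul (R := k) a)

end

section tliftLemmas

variable {R M N Q P : Type*} [CommRing R] [AddCommGroup M] [Module R M]
  [AddCommGroup N] [Module R N] [AddCommGroup Q] [Module R Q] [AddCommGroup P] [Module R P]

/-- On a bilinear function, `tlift` is the lift provided by the universal property. -/
theorem tlift_eq_lift {f : M → N → Q} (F : M →ₗ[R] N →ₗ[R] Q) (hF : ∀ x y, F x y = f x y) :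
    tlift R f = TensorProduct.lift F := by
  have h : ∃ G : M ⊗[R] N →ₗ[R] Q, ∀ x y, G (x ⊗ₜ[R] y) = f x y :=
    ⟨TensorProduct.lift F, fun x y => by simp [hF]⟩
  rw [tlift, dif_pos h]
  refine TensorProduct.ext' fun x y => ?_
  rw [h.choose_spec x y, TensorProduct.lift.tmul, hF]

theorem map_tlift {f : M → N → Q} (F : M →ₗ[R] N →ₗ[R] Q) (hF : ∀ x y, F x y = f x y)
    (g : Q →ₗ[R] P) (z : M ⊗[R] N) :
    g (tlift R f z) = tlift R (fun x y => g (f x y)) z := by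
  rw [tlift_eq_lift F hF, tlift_eq_lift (F.compr₂ g) (fun x y => by simp [hF])]
  simp [TensorProduct.lift_compr₂]

end tliftLemmas

section DualAct

universe v

variable {k : Type*} [Field k] {H Hs : Type v} [Ring H] [HopfAlgebra k H]
  [Ring Hs] [HopfAlgebra k Hs]

/-- The action of a fixed `h` on the dual is the contraction of the coproduct with `h`. -/
theorem dualAct_eq_contract (pair : Hs →ₗ[k] H →ₗ[k] k) (a : Hs) (h : H) :
    dualAct pair a h =
      TensorProduct.lift ((LinearMap.lsmul k Hs).comp (pair.flip h))
        (Coalgebra.comul (R := k) a) := by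
  rw [dualAct, tlift_eq_lift ((LinearMap.lsmul k Hs).comp (pair.flip h))]
  intro x y
  simp

theorem tlift_pair_smul_mul (pair : Hs →ₗ[k] H →ₗ[k] k) (a b : Hs) (h : H) :
    tlift k (fun a1 a2 => (pair a1 h : k) • (a2 * b)) (Coalgebra.comul (R := k) a) =
      dualAct pair a h * b := by
  have := map_tlift (R := k) (f := fun a1 a2 : Hs => (pair a1 h : k) • a2)
    ((LinearMap.lsmul k Hs).comp (pair.flip h)) (fun x y => by simp) (LinearMap.mulRight k b)
    (Coalgebra.comul (R := k) a)
  simpa [dualAct] using this.symm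

theorem counit_dualAct (pair : Hs →ₗ[k] H →ₗ[k] k)
    (hpcomul : ∀ (a : Hs) (h g : H),
      tlift k (fun a1 a2 => pair a1 h * pair a2 g) (Coalgebra.comul (R := k) a) =
        pair a (h * g))
    (hpcounit : ∀ a : Hs, (Coalgebra.counit (R := k) a : k) = pair a 1) (a : Hs) (h : H) :
    Coalgebra.counit (R := k) (dualAct pair a h) = pair a h := by
  rw [dualAct, map_tlift ((LinearMap.lsmul k Hs).comp (pair.flip h)) (fun x y => by simp)]
  simpa [hpcounit] using hpcomul a h 1

/-- A perfect pairing with a finite-dimensional space admits dual bases. -/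
theorem exists_dual_basis {V W : Type*} [AddCommGroup V] [Module k V] [FiniteDimensional k V]
    [AddCommGroup W] [Module k W] (pair : W →ₗ[k] V →ₗ[k] k)
    (hperf : Function.Bijective fun a : W => pair a) :
    ∃ (n : ℕ) (e : Fin n → V) (f : Fin n → W), ∀ a, ∑ i, pair a (e i) • f i = a := by
  let b := Module.finBasis k V
  choose f hf using fun i => hperf.2 (b.coord i)
  refine ⟨_, b, f, fun a => hperf.1 ?_⟩
  refine b.ext fun j => ?_
  simp only [map_sum, map_smul, LinearMap.sum_apply, LinearMap.smul_apply] at hf ⊢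
  simp [hf, Finsupp.single_apply]

/-- The coproduct of the dual, expressed through the action and dual bases. -/
theorem comul_eq_sum_dualAct (pair : Hs →ₗ[k] H →ₗ[k] k) {n : ℕ} {e : Fin n → H}
    {f : Fin n → Hs} (hef : ∀ a, ∑ i, pair a (e i) • f i = a) (a : Hs) :
    Coalgebra.comul (R := k) a = ∑ i, f i ⊗ₜ[k] dualAct pair a (e i) := by
  simp only [dualAct_eq_contract]
  generalize (Coalgebra.comul (R := k) a : Hs ⊗[k] Hs) = z
  induction z with
  | zero => simp
  | add x y hx hy =>
    simp only [map_add, TensorProduct.tmul_add, Finset.sum_add_distrib]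
    rw [← hx, ← hy]
  | tmul x y =>
    simp only [TensorProduct.lift.tmul, LinearMap.comp_apply, LinearMap.flip_apply,
      LinearMap.lsmul_apply, ← TensorProduct.smul_tmul, ← TensorProduct.sum_tmul, hef]

/-- A counital element generating a left ideal stable under the action is invertible. -/
theorem exists_inverse_of_dualAct_eq_mul [FiniteDimensional k H] (pair : Hs →ₗ[k] H →ₗ[k] k)
    (hperf : Function.Bijective fun a : Hs => pair a) {ϱ : H → Hs} {α : Hs}
    (hα : Coalgebra.counit (R := k) α = 1) (hϱ : ∀ h, dualAct pair α h = ϱ h * α) :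
    ∃ αi : Hs, α * αi = 1 ∧ αi * α = 1 := by
  obtain ⟨n, e, f, hef⟩ := exists_dual_basis pair hperf
  have : FiniteDimensional k Hs :=
    (LinearEquiv.ofBijective pair hperf).symm.finiteDimensional
  have : IsNoetherianRing Hs := IsNoetherianRing.of_finite k Hs
  have hleft : (∑ i, HopfAlgebra.antipode k (f i) * ϱ (e i)) * α = 1 := by
    have h := HopfAlgebra.mul_antipode_rTensor_comul_apply (R := k) α
    rw [comul_eq_sum_dualAct pair hef, hα] at h
    simpa [hϱ, Finset.sum_mul, mul_assoc] using h
  exact ⟨_, mul_eq_one_symm hleft, hleft⟩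

section Cocycles

variable {pair : Hs →ₗ[k] H →ₗ[k] k} {coact : Hs →ₗ[k] Hs ⊗[k] H}

theorem dualAct_mul_eq_mul_of_isZ1cross
    (hperf : Function.Bijective fun a : Hs => pair a)
    (hpmul : ∀ (a b : Hs) (h : H), pair (a * b) h =
      tlift k (fun h1 h2 => pair a h1 * pair b h2) (Coalgebra.comul (R := k) h))
    (hpcomul : ∀ (a : Hs) (h g : H),
      tlift k (fun a1 a2 => pair a1 h * pair a2 g) (Coalgebra.comul (R := k) a) =
        pair a (h * g))
    (hpcounit : ∀ a : Hs, (Coalgebra.counit (R := k) a : k) = pair a 1)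
    (hcross : IsRRCrossed (dualAct pair) coact) {ϱ : H →ₗ[k] Hs}
    (hϱ : IsZ1cross (dualAct pair) coact ϱ) {α : Hs}
    (hα : ∀ h, pair α h = Coalgebra.counit (R := k) (ϱ h)) (g : H) :
    dualAct pair α g = ϱ g * α := by
  obtain ⟨⟨A, hA⟩, -, -, hassoc, -⟩ := hcross
  have hcou := counit_dualAct pair hpcomul hpcounit
  refine hperf.1 (LinearMap.ext fun h => ?_)
  have h1 : pair (dualAct pair α g) h = pair α (g * h) := by
    rw [← hcou, hassoc, hcou]
  have h2 : pair α (g * h) = pair (ϱ g * α) h := by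
    rw [hα, hϱ.2.1, hpmul, map_tlift ((LinearMap.mul k Hs).compl₁₂ (A (ϱ g)) ϱ)
      (fun x y => by simp [hA])]
    simp only [Bialgebra.counit_mul, hcou, hα]
  exact h1.trans h2

theorem psiFun_dualAct_mul (hcross : IsRRCrossed (dualAct pair) coact)
    (hbr : IsBraidedComm (dualAct pair) coact) {α αi : Hs} {ϱ : H → Hs}
    (hϱ : ∀ h, ϱ h = dualAct pair α h * αi) (b : Hs) :
    psiFun coact ϱ b = α * b * αi := by
  obtain ⟨⟨A, hA⟩, -⟩ := hcross
  have := map_tlift (f := fun b0 b1 => b0 * dualAct pair α b1)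
    ((LinearMap.mul k Hs).compl₂ (A α)) (fun x y => by simp [hA])
    (LinearMap.mulRight k αi) (coact b)
  rw [← hbr] at this
  simpa [psiFun, hϱ, mul_assoc] using this.symm

theorem isZ1cross_of_eq_dualAct_mul (hcross : IsRRCrossed (dualAct pair) coact)
    (hbr : IsBraidedComm (dualAct pair) coact) {α αi : Hs} (h1 : α * αi = 1)
    (h2 : αi * α = 1) {ϱ : H →ₗ[k] Hs} (hϱ : ∀ h, ϱ h = dualAct pair α h * αi) :
    IsZ1cross (dualAct pair) coact ϱ := by
  have hψ := psiFun_dualAct_mul hcross hbr hϱ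
  obtain ⟨⟨A, hA⟩, -, hone, hassoc, -, hmul, -⟩ := hcross
  refine ⟨by rw [hϱ, hone, h1], fun g h => ?_, ?_⟩
  · have key := map_tlift (f := fun h1 h2 => dualAct pair (ϱ g) h1 * dualAct pair α h2)
      ((LinearMap.mul k Hs).compl₁₂ (A (ϱ g)) (A α)) (fun x y => by simp [hA])
      (LinearMap.mulRight k αi) (Coalgebra.comul (R := k) h)
    have hg : ϱ g * α = dualAct pair α g := by rw [hϱ, mul_assoc, h2, mul_one]
    rw [← hmul, hg, hassoc] at key
    simp only [LinearMap.mulRight_apply, mul_assoc, ← hϱ] at key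
    exact key
  · refine Function.bijective_iff_has_inverse.2 ⟨fun b => αi * b * α, fun b => ?_, fun b => ?_⟩
    · simp only [hψ]
      rw [show αi * (α * b * αi) * α = (αi * α) * b * (αi * α) by noncomm_ring, h2]
      simp
    · simp only [hψ]
      rw [show α * (αi * b * α) * αi = (α * αi) * b * (α * αi) by noncomm_ring, h1]
      simp

theorem bulletFun_dualAct_mul (hcross : IsRRCrossed (dualAct pair) coact)
    (hbr : IsBraidedComm (dualAct pair) coact) {α αi β βi : Hs} (h2 : αi * α = 1)
    {ϱ σ : H → Hs} (hϱ : ∀ h, ϱ h = dualAct pair α h * αi)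
    (hσ : ∀ h, σ h = dualAct pair β h * βi) (h : H) :
    bulletFun coact ϱ σ h = dualAct pair (α * β) h * (βi * αi) := by
  have hψ := psiFun_dualAct_mul hcross hbr hϱ
  obtain ⟨⟨A, hA⟩, -, -, -, -, hmul, -⟩ := hcross
  have key := map_tlift (f := fun h1 h2 => dualAct pair α h1 * dualAct pair β h2)
    ((LinearMap.mul k Hs).compl₁₂ (A α) (A β)) (fun x y => by simp [hA])
    (LinearMap.mulRight k (βi * αi)) (Coalgebra.comul (R := k) h)
  rw [← hmul, LinearMap.mulRight_apply] at key
  rw [key, bulletFun]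
  congr 2
  funext x y
  rw [hψ, hϱ, hσ, LinearMap.mulRight_apply,
    show dualAct pair α x * αi * (α * (dualAct pair β y * βi) * αi) =
      dualAct pair α x * (αi * α) * dualAct pair β y * (βi * αi) by noncomm_ring, h2, mul_one]

end Cocycles

end DualAct

/-- For a finite-dimensional Hopf algebra `H` with dual `H*` (presented as a
dually paired Hopf algebra with perfect pairing), `Z¹_◁(H,H*)` is identified, as a group, with
the group of counital invertible elements `α ∈ H*`, via `ϱ(h) = ⟨α₁,h⟩ α₂ α⁻¹`, with
`ψ(a) = α a α⁻¹` automatically bijective and counital, and the group product corresponding to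
multiplication in `H*`. -/
theorem Z1cross_of_dual_is_counital_units
    {k : Type u} [Field k] {H : Type v} [Ring H] [HopfAlgebra k H] [FiniteDimensional k H]
    {Hs : Type v} [Ring Hs] [HopfAlgebra k Hs]
    (pair : Hs →ₗ[k] H →ₗ[k] k)
    (hperf : Function.Bijective fun a : Hs => pair a)
    (hpmul : ∀ (a b : Hs) (h : H), pair (a * b) h =
      tlift k (fun h1 h2 => pair a h1 * pair b h2) (Coalgebra.comul (R := k) h))
    (hpone : ∀ h : H, pair 1 h = Coalgebra.counit (R := k) h)
    (hpcomul : ∀ (a : Hs) (h g : H),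
      tlift k (fun a1 a2 => pair a1 h * pair a2 g) (Coalgebra.comul (R := k) a) =
        pair a (h * g))
    (hpcounit : ∀ a : Hs, (Coalgebra.counit (R := k) a : k) = pair a 1)
    (hpantipode : ∀ (a : Hs) (h : H),
      pair (HopfAlgebra.antipode (R := k) a) h = pair a (HopfAlgebra.antipode (R := k) h))
    (coact : Hs →ₗ[k] Hs ⊗[k] H)
    (hcoact : ∀ a b : Hs,
      tlift k (fun a0 a1 => (pair b a1 : k) • a0) (coact a) =
      tlift k (fun b1 b2 => b1 * a * HopfAlgebra.antipode (R := k) b2)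
        (Coalgebra.comul (R := k) b))
    (hcross : IsRRCrossed (dualAct pair) (⇑coact))
    (hbr : IsBraidedComm (dualAct pair) (⇑coact)) :
    (∀ α αi : Hs, α * αi = 1 → αi * α = 1 → (Coalgebra.counit (R := k) α : k) = 1 →
      ∃ ϱ : H →ₗ[k] Hs,
        (∀ h : H, ϱ h = tlift k (fun a1 a2 => (pair a1 h : k) • (a2 * αi))
          (Coalgebra.comul (R := k) α)) ∧
        IsZ1cross (dualAct pair) (⇑coact) ϱ ∧
        (∀ b : Hs, psiFun (⇑coact) (⇑ϱ) b = α * b * αi) ∧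
        (∀ b : Hs, (Coalgebra.counit (R := k) (α * b * αi) : k) =
          Coalgebra.counit (R := k) b)) ∧
    (∃ e : {p : Hs × Hs // p.1 * p.2 = 1 ∧ p.2 * p.1 = 1 ∧
        (Coalgebra.counit (R := k) p.1 : k) = 1} ≃
        {ϱ : H →ₗ[k] Hs // IsZ1cross (dualAct pair) (⇑coact) ϱ},
      (∀ p, ∀ h : H, (e p).1 h = tlift k (fun a1 a2 => (pair a1 h : k) • (a2 * p.1.2))
        (Coalgebra.comul (R := k) p.1.1)) ∧
      (∀ p q pq, pq.1.1 = p.1.1 * q.1.1 →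
        ∀ h : H, (e pq).1 h = bulletFun (⇑coact) (⇑(e p).1) (⇑(e q).1) h)) := by
  have hcou := counit_dualAct pair hpcomul hpcounit
  obtain ⟨A, hA⟩ := hcross.1
  let ρ : Hs → Hs → H →ₗ[k] Hs := fun α αi => (LinearMap.mulRight k αi).comp (A α)
  have hρ : ∀ α αi h, ρ α αi h = dualAct pair α h * αi := fun α αi h => by simp [ρ, hA]
  have counit_inv : ∀ {α αi : Hs}, α * αi = 1 → Coalgebra.counit (R := k) α = 1 →
      Coalgebra.counit (R := k) αi = 1 := fun {α αi} h hα => by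
    simpa [hα] using congrArg (Coalgebra.counit (R := k)) h
  refine ⟨fun α αi h1 h2 hα => ⟨ρ α αi, fun h => ?_,
    isZ1cross_of_eq_dualAct_mul hcross hbr h1 h2 (hρ α αi),
    psiFun_dualAct_mul hcross hbr (hρ α αi), fun b => by simp [hα, counit_inv h1 hα]⟩, ?_⟩
  · rw [hρ, tlift_pair_smul_mul]
  let E : {p : Hs × Hs // p.1 * p.2 = 1 ∧ p.2 * p.1 = 1 ∧
        (Coalgebra.counit (R := k) p.1 : k) = 1} →
        {ϱ : H →ₗ[k] Hs // IsZ1cross (dualAct pair) (⇑coact) ϱ} := fun p =>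
    ⟨ρ p.1.1 p.1.2, isZ1cross_of_eq_dualAct_mul hcross hbr p.2.1 p.2.2.1 (hρ _ _)⟩
  have hE : Function.Bijective E := by
    constructor
    · rintro ⟨⟨α, αi⟩, h1, h2, hα⟩ ⟨⟨β, βi⟩, h1', h2', hβ⟩ heq
      have hϱ : ρ α αi = ρ β βi := congrArg Subtype.val heq
      have hαβ : α = β := hperf.1 <| LinearMap.ext fun h => by
        have := congrArg (Coalgebra.counit (R := k)) (LinearMap.congr_fun hϱ h)
        simpa [hρ, hcou, counit_inv h1 hα, counit_inv h1' hβ] using this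
      subst hαβ
      have : αi = βi := left_inv_eq_right_inv h2 h1'
      subst this
      rfl
    · rintro ⟨ϱ, hϱ⟩
      obtain ⟨α, hα⟩ := hperf.2 ((Coalgebra.counit (R := k) (A := Hs)).comp ϱ)
      have hα' : ∀ h, pair α h = Coalgebra.counit (R := k) (ϱ h) :=
        fun h => LinearMap.congr_fun hα h
      have hact := dualAct_mul_eq_mul_of_isZ1cross hperf hpmul hpcomul hpcounit hcross hϱ hα'
      have hα1 : Coalgebra.counit (R := k) α = 1 := by
        rw [hpcounit, hα', hϱ.1, Bialgebra.counit_one]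
      obtain ⟨αi, h1, h2⟩ := exists_inverse_of_dualAct_eq_mul pair hperf hα1 hact
      refine ⟨⟨(α, αi), h1, h2, hα1⟩, Subtype.ext (LinearMap.ext fun h => ?_)⟩
      change ρ α αi h = ϱ h
      rw [hρ, hact, mul_assoc, h1, mul_one]
  refine ⟨Equiv.ofBijective E hE, fun p h => ?_, fun p q pq hpq h => ?_⟩
  · rw [tlift_pair_smul_mul]
    exact hρ _ _ h
  · have hinv : pq.1.2 = q.1.2 * p.1.2 := by
      refine left_inv_eq_right_inv pq.2.2.1 ?_
      rw [hpq, mul_assoc, ← mul_assoc q.1.1, q.2.1, one_mul, p.2.1]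
    have hb := bulletFun_dualAct_mul hcross hbr p.2.2.1 (hρ p.1.1 p.1.2) (hρ q.1.1 q.1.2) h
    rw [← hpq, ← hinv, ← hρ] at hb
    exact hb.symm
end
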